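/- Let d = 2, let Γ be a 2×2 symmetric positive definite real matrix, and let R be a 2×2 P-matrix. Suppose that for each r ∈ (0,1) there are Borel probability measures π^r, ν_1^r, ν_2^r on ℝ₊² satisfying the basic adjoint relationship. Then, as r → 0, the pushforward of π^r under the map z ↦ (r z_1, r² z_2) converges weakly to the law of (Z_1*, Z_2*), where Z_1* and Z_2* are independent exponential random variables with means m_1 = Γ_{11}/(2R_{11}) and m_2 = (u_2ᵀ Γ u_2)/(2 u_2ᵀ R_{:,2}), with u_2 = (−R_{21}/R_{11}, 1)ᵀ, and m_1, m_2 > 0. -/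

import Mathlib

open MeasureTheory Filter

noncomputable section

namespace SRBMPaper

/-- The nonnegative orthant `ℝ₊^d`. -/
def posOrthant (d : ℕ) : Set (Fin d → ℝ) := {z | ∀ i, 0 ≤ z i}

/-- `R` is a P-matrix: every principal minor is positive. -/
def IsPMatrix {d : ℕ} (R : Matrix (Fin d) (Fin d) ℝ) : Prop :=
  ∀ s : Finset (Fin d),
    0 < (R.submatrix (fun i : s => (i : Fin d)) (fun i : s => (i : Fin d))).det

/-- `R` is a nonsingular M-matrix: nonpositive off-diagonal entries and
every principal minor positive. -/
def IsMMatrix {d : ℕ} (R : Matrix (Fin d) (Fin d) ℝ) : Prop :=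
  (∀ i j, i ≠ j → R i j ≤ 0) ∧ IsPMatrix R

/-- First-order partial derivative of `f` in coordinate `j`. -/
def pd1 {d : ℕ} (f : (Fin d → ℝ) → ℝ) (j : Fin d) (z : Fin d → ℝ) : ℝ :=
  fderiv ℝ f z (Pi.single j 1)

/-- Second-order partial derivative of `f` in coordinates `i`, `j`. -/
def pd2 {d : ℕ} (f : (Fin d → ℝ) → ℝ) (i j : Fin d) (z : Fin d → ℝ) : ℝ :=
  fderiv ℝ (fun w => pd1 f j w) z (Pi.single i 1)

/-- `f` is twice continuously differentiable and `f` together with all of its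
first- and second-order partial derivatives is bounded on the orthant. -/
def IsC2Bounded {d : ℕ} (f : (Fin d → ℝ) → ℝ) : Prop :=
  ContDiff ℝ 2 f ∧
    ∃ C : ℝ, ∀ z ∈ posOrthant d,
      |f z| ≤ C ∧ (∀ j, |pd1 f j z| ≤ C) ∧ (∀ i j, |pd2 f i j z| ≤ C)

/-- The basic adjoint relationship (BAR) at traffic-intensity parameter `r`. -/
def SatisfiesBAR {d : ℕ} (Γ R : Matrix (Fin d) (Fin d) ℝ) (r : ℝ)
    (π : Measure (Fin d → ℝ)) (ν : Fin d → Measure (Fin d → ℝ)) : Prop :=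
  ∀ f : (Fin d → ℝ) → ℝ, IsC2Bounded f →
    (1 / 2) * (∫ z, ∑ i, ∑ j, Γ i j * pd2 f i j z ∂π)
      - (∑ i : Fin d, r ^ ((i : ℕ) + 1) * ∫ z, ∑ j, R j i * pd1 f j z ∂π)
      + (∑ i : Fin d, r ^ ((i : ℕ) + 1) * ∫ z, ∑ j, R j i * pd1 f j z ∂(ν i)) = 0

/-- For every `r ∈ (0,1)`, `π r` is a Borel probability measure on the orthant,
each `ν i r` is a Borel probability measure on the face `{z i = 0}` of the orthant,
and together they satisfy the basic adjoint relationship. -/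
def BARFamily {d : ℕ} (Γ R : Matrix (Fin d) (Fin d) ℝ)
    (π : ℝ → Measure (Fin d → ℝ)) (ν : Fin d → ℝ → Measure (Fin d → ℝ)) : Prop :=
  ∀ r ∈ Set.Ioo (0 : ℝ) 1,
    IsProbabilityMeasure (π r) ∧ π r (posOrthant d) = 1 ∧
    (∀ i, IsProbabilityMeasure (ν i r) ∧
      ν i r {z | z ∈ posOrthant d ∧ z i = 0} = 1) ∧
    SatisfiesBAR Γ R r (π r) (fun i => ν i r)

/-- `u` is the vector `u_k` associated with the matrix `R`:
`u_k = (w_{1k}, …, w_{k-1,k}, 1, 0, …, 0)ᵀ` where the weights solve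
`∑_{j<k} w_{jk} R_{jℓ} + R_{kℓ} = 0` for all `ℓ < k`. -/
def IsUk {d : ℕ} (R : Matrix (Fin d) (Fin d) ℝ) (k : Fin d) (u : Fin d → ℝ) : Prop :=
  u k = 1 ∧ (∀ j, k < j → u j = 0) ∧
    ∀ ℓ, ℓ < k →
      (∑ j ∈ Finset.univ.filter (fun j => j < k), u j * R j ℓ) + R k ℓ = 0

/-- `uᵀ R_{:,i}`, the pairing of `u` with the `i`-th column of `R`. -/
def uR {d : ℕ} (R : Matrix (Fin d) (Fin d) ℝ) (u : Fin d → ℝ) (i : Fin d) : ℝ :=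
  ∑ j, u j * R j i

/-- The quadratic form `uᵀ Γ u`. -/
def quadForm {d : ℕ} (Γ : Matrix (Fin d) (Fin d) ℝ) (u : Fin d → ℝ) : ℝ :=
  ∑ i, ∑ j, u i * Γ i j * u j

/-- The limiting mean `m_k = (u_kᵀ Γ u_k) / (2 u_kᵀ R_{:,k})`. -/
def meanOf {d : ℕ} (Γ R : Matrix (Fin d) (Fin d) ℝ) (u : Fin d → ℝ) (k : Fin d) : ℝ :=
  quadForm Γ u / (2 * uR R u k)

/-- The exponential distribution on `ℝ` with mean `m`. -/
def expMean (m : ℝ) : Measure ℝ :=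
  (volume : Measure ℝ).withDensity fun x =>
    ENNReal.ofReal (if 0 ≤ x then m⁻¹ * Real.exp (-x / m) else 0)

/-- The law of a vector of independent exponential random variables with means `m k`. -/
def prodExp {d : ℕ} (m : Fin d → ℝ) : Measure (Fin d → ℝ) :=
  Measure.pi fun k => expMean (m k)

/-- The pushforwards of `π r` under `z ↦ (r z_1, r² z_2, …, r^d z_d)` converge weakly
to `μ` as `r → 0` (convergence tested against bounded continuous functions). -/
def ScaledWeakLimit {d : ℕ} (π : ℝ → Measure (Fin d → ℝ)) (μ : Measure (Fin d → ℝ)) : Prop :=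
  ∀ g : BoundedContinuousFunction (Fin d → ℝ) ℝ,
    Tendsto (fun r : ℝ => ∫ z, g (fun i => r ^ ((i : ℕ) + 1) * z i) ∂(π r))
      (nhdsWithin 0 (Set.Ioo 0 1)) (nhds (∫ z, g z ∂μ))

/-- The uniform moment bound condition: for all coordinates `i, k`, the `d`-th moment
of `r^k Z_k` under `π r` is bounded for small `r`, and `r` times its `d`-th moment
under `ν i r` tends to `0` as `r → 0`. -/
def UniformMomentBound {d : ℕ} (π : ℝ → Measure (Fin d → ℝ))
    (ν : Fin d → ℝ → Measure (Fin d → ℝ)) : Prop :=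
  ∀ i k : Fin d,
    (∃ r₁ > (0 : ℝ), ∃ C : ℝ, ∀ r ∈ Set.Ioo (0 : ℝ) (min r₁ 1),
      (∫ z, (r ^ ((k : ℕ) + 1) * z k) ^ d ∂(π r)) ≤ C) ∧
    Tendsto (fun r : ℝ => r * ∫ z, (r ^ ((k : ℕ) + 1) * z k) ^ d ∂(ν i r))
      (nhdsWithin 0 (Set.Ioo 0 1)) (nhds 0)

/-- The truncation function `κ`. -/
def kappa (x : ℝ) : ℝ :=
  if x ≤ 1 then x
  else if x ≤ 2 then 3*x^5 - 22*x^4 + 62*x^3 - 84*x^2 + 56*x - 14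
  else 2

/-- The vector `θ_k^{(r)} = ∑_{ℓ=k}^d r^ℓ η_ℓ u_ℓ`. -/
def thetaK {d : ℕ} (u : Fin d → Fin d → ℝ) (η : Fin d → ℝ) (k : Fin d) (r : ℝ) :
    Fin d → ℝ :=
  fun j => ∑ ℓ ∈ Finset.univ.filter (fun ℓ => k ≤ ℓ), r ^ ((ℓ : ℕ) + 1) * η ℓ * u ℓ j

/-- The vector `θ̃_k^{(r)} = r^{k+1/2} η_k u_k + ∑_{ℓ=k+1}^d r^ℓ η_ℓ u_ℓ`. -/
def thetaKt {d : ℕ} (u : Fin d → Fin d → ℝ) (η : Fin d → ℝ) (k : Fin d) (r : ℝ) :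
    Fin d → ℝ :=
  fun j => r ^ ((((k : ℕ) : ℝ) + 1) + 1/2) * η k * u k j
    + ∑ ℓ ∈ Finset.univ.filter (fun ℓ => k < ℓ), r ^ ((ℓ : ℕ) + 1) * η ℓ * u ℓ j

/-- The truncated exponential test function `f̃_θ(z) = exp(∑ κ(θ_i z_i))`. -/
def ftilde {d : ℕ} (θ z : Fin d → ℝ) : ℝ := Real.exp (∑ i, kappa (θ i * z i))

/-- Gradient extra term `ε_{g,θ,j}(z) = θ_j (κ'(θ_j z_j) − 1)`. -/
def epsG {d : ℕ} (θ : Fin d → ℝ) (j : Fin d) (z : Fin d → ℝ) : ℝ :=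
  θ j * (deriv kappa (θ j * z j) - 1)

/-- Hessian extra term `ε_{H,θ,ij}(z)`. -/
def epsH {d : ℕ} (θ : Fin d → ℝ) (i j : Fin d) (z : Fin d → ℝ) : ℝ :=
  θ i * θ j * (deriv kappa (θ i * z i) * deriv kappa (θ j * z j) - 1)
    + (if i = j then θ i ^ 2 * deriv (deriv kappa) (θ i * z i) else 0)

/-- The extra term `γ^r(θ)` in the truncated MGF-BAR. -/
def gammaTerm {d : ℕ} (Γ R : Matrix (Fin d) (Fin d) ℝ) (r : ℝ)
    (π : Measure (Fin d → ℝ)) (ν : Fin d → Measure (Fin d → ℝ))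
    (θ : Fin d → ℝ) : ℝ :=
  (1/2) * (∫ z, (∑ i, ∑ j, Γ i j * epsH θ i j z) * ftilde θ z ∂π)
    + ∑ i : Fin d, r ^ ((i : ℕ) + 1) *
        ((∫ z, (∑ j, epsG θ j z * R j i) * ftilde θ z ∂(ν i))
          - ∫ z, (∑ j, epsG θ j z * R j i) * ftilde θ z ∂π)

lemma isProbabilityMeasure_expMean {m : ℝ} (hm : 0 < m) : IsProbabilityMeasure (expMean m) := by
  refine ⟨?_⟩
  rw [← ProbabilityTheory.lintegral_exponentialPDF_eq_one (inv_pos.2 hm), expMean,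
    withDensity_apply _ MeasurableSet.univ, Measure.restrict_univ]
  refine lintegral_congr fun x => ?_
  rw [ProbabilityTheory.exponentialPDF_eq]
  congr 4
  field_simp

lemma charFun_expMean {m : ℝ} (hm : 0 < m) (t : ℝ) :
    charFun (expMean m) t = (1 - Complex.I * m * t)⁻¹ := by
  have hmeas : Measurable fun x : ℝ => if 0 ≤ x then m⁻¹ * Real.exp (-x / m) else 0 :=
    Measurable.ite measurableSet_Ici (by fun_prop) measurable_const
  have hm' : (m : ℂ) ≠ 0 := by exact_mod_cast hm.ne'
  have hre : (-(m : ℂ)⁻¹ + t * Complex.I).re < 0 := by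
    rw [← Complex.ofReal_inv]
    simp [hm]
  have hne : -(m : ℂ)⁻¹ + t * Complex.I ≠ 0 := fun h => by simp [h] at hre
  rw [charFun_apply_real, expMean, integral_withDensity_eq_integral_toReal_smul
    hmeas.ennreal_ofReal (by simp)]
  have h1 : ∀ x : ℝ, (ENNReal.ofReal (if 0 ≤ x then m⁻¹ * Real.exp (-x / m) else 0)).toReal •
      Complex.exp (t * x * Complex.I) = (Set.Ici (0 : ℝ)).indicator
        (fun x : ℝ => (m : ℂ)⁻¹ * Complex.exp ((-(m : ℂ)⁻¹ + t * Complex.I) * x)) x := by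
    intro x
    by_cases hx : 0 ≤ x
    · rw [Set.indicator_of_mem (by exact hx), if_pos hx, ENNReal.toReal_ofReal (by positivity),
        Complex.real_smul]
      push_cast
      rw [mul_assoc, ← Complex.exp_add]
      congr 2
      field_simp
    · rw [Set.indicator_of_notMem (by exact hx), if_neg hx]
      simp
  simp_rw [h1]
  rw [integral_indicator measurableSet_Ici, integral_Ici_eq_integral_Ioi, integral_const_mul,
    integral_exp_mul_complex_Ioi hre]
  simp only [Complex.ofReal_zero, mul_zero, Complex.exp_zero]
  field_simp
  have h2 : 1 - (m : ℂ) * t * Complex.I = -(-1 + m * t * Complex.I) := by ring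
  rw [h2, div_neg]

/-- The characteristic function of a measure on `ℝ²`, in coordinates. -/
def charFun₂ (μ : Measure (Fin 2 → ℝ)) (α β : ℝ) : ℂ :=
  ∫ z, Complex.exp ((α * z 0 + β * z 1 : ℝ) * Complex.I) ∂μ

lemma scaledWeakLimit_of_tendsto_charFun {π : ℝ → Measure (Fin 2 → ℝ)} {m : Fin 2 → ℝ}
    (hπ : ∀ r ∈ Set.Ioo (0 : ℝ) 1, IsProbabilityMeasure (π r)) (hm : ∀ i, 0 < m i)
    (h : ∀ s t : ℝ, Tendsto
      (fun r : ℝ => charFun₂ (π r) (r * s) (r ^ 2 * t))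
      (nhdsWithin 0 (Set.Ioo 0 1))
      (nhds ((1 - Complex.I * m 0 * s)⁻¹ * (1 - Complex.I * m 1 * t)⁻¹))) :
    ScaledWeakLimit π (prodExp m) := by
  have hexp (i : Fin 2) : IsProbabilityMeasure (expMean (m i)) := isProbabilityMeasure_expMean (hm i)
  have hprod : IsProbabilityMeasure (prodExp m) := by unfold prodExp; infer_instance
  intro g
  refine tendsto_of_seq_tendsto fun u hu => ?_
  have hmem : ∀ᶠ n in atTop, u n ∈ Set.Ioo (0 : ℝ) 1 := hu.eventually self_mem_nhdsWithin
  let v : ℕ → ℝ := fun n => if u n ∈ Set.Ioo (0 : ℝ) 1 then u n else 1 / 2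
  have hv (n) : v n ∈ Set.Ioo (0 : ℝ) 1 := by
    by_cases hn : u n ∈ Set.Ioo (0 : ℝ) 1
    · simp only [v, if_pos hn]; exact hn
    · simp only [v, if_neg hn]; norm_num
  have huv : u =ᶠ[atTop] v := hmem.mono fun n hn => by simp only [v, if_pos hn]
  have hv' : Tendsto v atTop (nhdsWithin 0 (Set.Ioo 0 1)) := hu.congr' huv
  suffices Tendsto (fun n => ∫ z, g (fun i => v n ^ ((i : ℕ) + 1) * z i) ∂(π (v n))) atTop
      (nhds (∫ z, g z ∂(prodExp m))) from
    this.congr' (huv.mono fun n hn => congrArg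
      (fun x : ℝ => ∫ z, g (fun i => x ^ ((i : ℕ) + 1) * z i) ∂(π x)) hn.symm)
  have hpv (n) : IsProbabilityMeasure (π (v n)) := hπ _ (hv n)
  let S : ℕ → (Fin 2 → ℝ) → EuclideanSpace ℝ (Fin 2) :=
    fun n z => WithLp.toLp 2 fun i => v n ^ ((i : ℕ) + 1) * z i
  have hS (n) : Measurable (S n) := by fun_prop
  let μ : ℕ → ProbabilityMeasure (EuclideanSpace ℝ (Fin 2)) := fun n =>
    ⟨(π (v n)).map (S n), Measure.isProbabilityMeasure_map (hS n).aemeasurable⟩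
  let μ₀ : ProbabilityMeasure (EuclideanSpace ℝ (Fin 2)) :=
    ⟨(prodExp m).map (WithLp.toLp 2), Measure.isProbabilityMeasure_map (by fun_prop)⟩
  have hlim : Tendsto μ atTop (nhds μ₀) := by
    refine ProbabilityMeasure.tendsto_iff_tendsto_charFun.2 fun t => ?_
    have h0 : charFun (μ₀ : Measure (EuclideanSpace ℝ (Fin 2))) t =
        (1 - Complex.I * m 0 * t 0)⁻¹ * (1 - Complex.I * m 1 * t 1)⁻¹ := by
      change charFun ((Measure.pi fun k => expMean (m k)).map (WithLp.toLp 2)) t = _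
      rw [charFun_pi, Fin.prod_univ_two, charFun_expMean (hm 0), charFun_expMean (hm 1)]
    rw [h0]
    refine ((h (t 0) (t 1)).comp hv').congr fun n => ?_
    change _ = charFun ((π (v n)).map (S n)) t
    rw [charFun_apply, integral_map (hS n).aemeasurable (by fun_prop)]
    rw [Function.comp_apply, charFun₂]
    refine integral_congr_ae (ae_of_all _ fun z => ?_)
    simp only [S, PiLp.inner_apply, Fin.sum_univ_two]
    congr 3
    simp
    ring
  rw [ProbabilityMeasure.tendsto_iff_forall_integral_tendsto] at hlim
  let G : BoundedContinuousFunction (EuclideanSpace ℝ (Fin 2)) ℝ :=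
    g.compContinuous ⟨WithLp.ofLp, by fun_prop⟩
  have := hlim G
  have e0 : ∫ x, G x ∂(μ₀ : Measure (EuclideanSpace ℝ (Fin 2))) = ∫ z, g z ∂(prodExp m) := by
    change ∫ x, G x ∂((prodExp m).map (WithLp.toLp 2)) = _
    rw [integral_map (by fun_prop) G.continuous.aestronglyMeasurable]
    rfl
  rw [e0] at this
  refine this.congr fun n => ?_
  change ∫ x, G x ∂((π (v n)).map (S n)) = _
  rw [integral_map (hS n).aemeasurable G.continuous.aestronglyMeasurable]
  rfl

lemma pd1_eq_of_hasFDerivAt {f f0 f1 : (Fin 2 → ℝ) → ℝ} {z : Fin 2 → ℝ}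
    (h : HasFDerivAt f (f0 z • ContinuousLinearMap.proj (R := ℝ) (φ := fun _ : Fin 2 => ℝ) 0 +
      f1 z • ContinuousLinearMap.proj (R := ℝ) (φ := fun _ : Fin 2 => ℝ) 1) z) :
    pd1 f 0 z = f0 z ∧ pd1 f 1 z = f1 z := by
  simp [pd1, h.fderiv]

/-- `f0` and `f1` are the partial derivatives of `f`. -/
def HasGradient2 (f f0 f1 : (Fin 2 → ℝ) → ℝ) : Prop :=
  ∀ z, HasFDerivAt f (f0 z • ContinuousLinearMap.proj (R := ℝ) (φ := fun _ : Fin 2 => ℝ) 0 +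
      f1 z • ContinuousLinearMap.proj (R := ℝ) (φ := fun _ : Fin 2 => ℝ) 1) z

lemma HasGradient2.pd1_zero {f f0 f1 : (Fin 2 → ℝ) → ℝ} (h : HasGradient2 f f0 f1) :
    pd1 f 0 = f0 := funext fun z => (pd1_eq_of_hasFDerivAt (h z)).1

lemma HasGradient2.pd1_one {f f0 f1 : (Fin 2 → ℝ) → ℝ} (h : HasGradient2 f f0 f1) :
    pd1 f 1 = f1 := funext fun z => (pd1_eq_of_hasFDerivAt (h z)).2

/-- `f` is bounded on the orthant. -/
def OrthantBounded (f : (Fin 2 → ℝ) → ℝ) : Prop := ∃ C, ∀ z ∈ posOrthant 2, |f z| ≤ C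

/-- The basic adjoint relationship in dimension two, written out with explicit derivatives. -/
lemma SatisfiesBAR.eq_two_dim {Γ R : Matrix (Fin 2) (Fin 2) ℝ} {r : ℝ}
    {π : Measure (Fin 2 → ℝ)} {ν : Fin 2 → Measure (Fin 2 → ℝ)} (hΓ : Γ.IsSymm)
    (h : SatisfiesBAR Γ R r π ν) {f f0 f1 f00 f01 f11 : (Fin 2 → ℝ) → ℝ}
    (hf : ContDiff ℝ 2 f) (hg : HasGradient2 f f0 f1) (hg0 : HasGradient2 f0 f00 f01)
    (hg1 : HasGradient2 f1 f01 f11) (b : OrthantBounded f) (b0 : OrthantBounded f0)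
    (b1 : OrthantBounded f1) (b00 : OrthantBounded f00) (b01 : OrthantBounded f01)
    (b11 : OrthantBounded f11) :
    (1 / 2) * (∫ z, (Γ 0 0 * f00 z + 2 * Γ 0 1 * f01 z + Γ 1 1 * f11 z) ∂π)
      - (r * (∫ z, (R 0 0 * f0 z + R 1 0 * f1 z) ∂π) +
          r ^ 2 * ∫ z, (R 0 1 * f0 z + R 1 1 * f1 z) ∂π)
      + (r * (∫ z, (R 0 0 * f0 z + R 1 0 * f1 z) ∂(ν 0)) +
          r ^ 2 * ∫ z, (R 0 1 * f0 z + R 1 1 * f1 z) ∂(ν 1)) = 0 := by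
  have p00 : pd2 f 0 0 = f00 := by
    funext z; rw [← hg0.pd1_zero, ← hg.pd1_zero]; rfl
  have p10 : pd2 f 1 0 = f01 := by
    funext z; rw [← hg0.pd1_one, ← hg.pd1_zero]; rfl
  have p01 : pd2 f 0 1 = f01 := by
    funext z; rw [← hg1.pd1_zero, ← hg.pd1_one]; rfl
  have p11 : pd2 f 1 1 = f11 := by
    funext z; rw [← hg1.pd1_one, ← hg.pd1_one]; rfl
  have hC : IsC2Bounded f := by
    obtain ⟨C, hC⟩ := b
    obtain ⟨C0, hC0⟩ := b0
    obtain ⟨C1, hC1⟩ := b1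
    obtain ⟨C00, hC00⟩ := b00
    obtain ⟨C01, hC01⟩ := b01
    obtain ⟨C11, hC11⟩ := b11
    refine ⟨hf, |C| + |C0| + |C1| + |C00| + |C01| + |C11|, fun z hz => ?_⟩
    have := hC z hz
    have := hC0 z hz
    have := hC1 z hz
    have := hC00 z hz
    have := hC01 z hz
    have := hC11 z hz
    have := le_abs_self C
    have := le_abs_self C0
    have := le_abs_self C1
    have := le_abs_self C00
    have := le_abs_self C01
    have := le_abs_self C11
    have := abs_nonneg C
    have := abs_nonneg C0
    have := abs_nonneg C1
    have := abs_nonneg C00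
    have := abs_nonneg C01
    have := abs_nonneg C11
    refine ⟨by linarith, ?_, ?_⟩
    · rw [Fin.forall_fin_two, hg.pd1_zero, hg.pd1_one]
      constructor <;> linarith
    · simp only [Fin.forall_fin_two, p00, p01, p10, p11]
      refine ⟨⟨?_, ?_⟩, ?_, ?_⟩ <;> linarith
  have key := h f hC
  have hsymm : Γ 1 0 = Γ 0 1 := hΓ.apply 0 1
  simp only [Fin.sum_univ_two, p00, p01, p10, p11, hg.pd1_zero, hg.pd1_one, hsymm] at key
  simp only [Fin.val_zero, Fin.val_one, zero_add, pow_one] at key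
  have e : (fun z => Γ 0 0 * f00 z + 2 * Γ 0 1 * f01 z + Γ 1 1 * f11 z) = fun z =>
      Γ 0 0 * f00 z + Γ 0 1 * f01 z + (Γ 0 1 * f01 z + Γ 1 1 * f11 z) := by funext z; ring
  rw [e]
  linear_combination key

lemma hasGradient2_ridge {H H' : ℝ → ℝ} (hH : ∀ x, HasDerivAt H (H' x) x) (c α β : ℝ) :
    HasGradient2 (fun z => c * H (α * z 0 + β * z 1)) (fun z => c * α * H' (α * z 0 + β * z 1))
      (fun z => c * β * H' (α * z 0 + β * z 1)) := by
  intro z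
  have h0 : HasFDerivAt (fun z : Fin 2 → ℝ => α * z 0 + β * z 1)
      (α • ContinuousLinearMap.proj (R := ℝ) (φ := fun _ : Fin 2 => ℝ) 0 +
        β • ContinuousLinearMap.proj (R := ℝ) (φ := fun _ : Fin 2 => ℝ) 1) z :=
    ((hasFDerivAt_apply (𝕜 := ℝ) 0 z).const_mul α).add
      ((hasFDerivAt_apply (𝕜 := ℝ) 1 z).const_mul β)
  refine (((hH _).comp_hasFDerivAt z h0).const_mul c).congr_fderiv ?_
  ext v
  simp
  ring

lemma hasGradient2_mul {A A' B B' : ℝ → ℝ} (hA : ∀ x, HasDerivAt A (A' x) x)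
    (hB : ∀ x, HasDerivAt B (B' x) x) :
    HasGradient2 (fun z => A (z 0) * B (z 1)) (fun z => A' (z 0) * B (z 1))
      (fun z => A (z 0) * B' (z 1)) := by
  intro z
  refine (((hA _).comp_hasFDerivAt z (hasFDerivAt_apply (𝕜 := ℝ) 0 z)).mul
    ((hB _).comp_hasFDerivAt z (hasFDerivAt_apply (𝕜 := ℝ) 1 z))).congr_fderiv ?_
  ext v
  simp
  ring

lemma orthantBounded_mul {A B : ℝ → ℝ} {CA CB : ℝ} (hA : ∀ x, 0 ≤ x → |A x| ≤ CA)
    (hB : ∀ x, 0 ≤ x → |B x| ≤ CB) : OrthantBounded fun z => A (z 0) * B (z 1) := by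
  refine ⟨CA * CB, fun z hz => ?_⟩
  rw [abs_mul]
  exact mul_le_mul (hA _ (hz 0)) (hB _ (hz 1)) (abs_nonneg _)
    ((abs_nonneg _).trans (hA _ (hz 0)))

lemma SatisfiesBAR.eq_mul {Γ R : Matrix (Fin 2) (Fin 2) ℝ} {r : ℝ}
    {π : Measure (Fin 2 → ℝ)} {ν : Fin 2 → Measure (Fin 2 → ℝ)} (hΓ : Γ.IsSymm)
    (h : SatisfiesBAR Γ R r π ν) {A A' A'' B B' B'' : ℝ → ℝ}
    (cA : ContDiff ℝ 2 A) (cB : ContDiff ℝ 2 B)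
    (hA : ∀ x, HasDerivAt A (A' x) x) (hA' : ∀ x, HasDerivAt A' (A'' x) x)
    (hB : ∀ x, HasDerivAt B (B' x) x) (hB' : ∀ x, HasDerivAt B' (B'' x) x)
    {CA CA' CA'' CB CB' CB'' : ℝ}
    (bA : ∀ x, 0 ≤ x → |A x| ≤ CA) (bA' : ∀ x, 0 ≤ x → |A' x| ≤ CA')
    (bA'' : ∀ x, 0 ≤ x → |A'' x| ≤ CA'')
    (bB : ∀ x, 0 ≤ x → |B x| ≤ CB) (bB' : ∀ x, 0 ≤ x → |B' x| ≤ CB')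
    (bB'' : ∀ x, 0 ≤ x → |B'' x| ≤ CB'') :
    (1 / 2) * (∫ z, (Γ 0 0 * (A'' (z 0) * B (z 1)) + 2 * Γ 0 1 * (A' (z 0) * B' (z 1))
        + Γ 1 1 * (A (z 0) * B'' (z 1))) ∂π)
      - (r * (∫ z, (R 0 0 * (A' (z 0) * B (z 1)) + R 1 0 * (A (z 0) * B' (z 1))) ∂π) +
          r ^ 2 * ∫ z, (R 0 1 * (A' (z 0) * B (z 1)) + R 1 1 * (A (z 0) * B' (z 1))) ∂π)
      + (r * (∫ z, (R 0 0 * (A' (z 0) * B (z 1)) + R 1 0 * (A (z 0) * B' (z 1))) ∂(ν 0)) +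
          r ^ 2 * ∫ z, (R 0 1 * (A' (z 0) * B (z 1)) + R 1 1 * (A (z 0) * B' (z 1))) ∂(ν 1))
      = 0 :=
  h.eq_two_dim hΓ (by fun_prop) (hasGradient2_mul hA hB) (hasGradient2_mul hA' hB)
    (hasGradient2_mul hA hB') (orthantBounded_mul bA bB) (orthantBounded_mul bA' bB)
    (orthantBounded_mul bA bB') (orthantBounded_mul bA'' bB) (orthantBounded_mul bA' bB')
    (orthantBounded_mul bA bB'')

lemma SatisfiesBAR.eq_ridge {Γ R : Matrix (Fin 2) (Fin 2) ℝ} {r : ℝ}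
    {π : Measure (Fin 2 → ℝ)} {ν : Fin 2 → Measure (Fin 2 → ℝ)} (hΓ : Γ.IsSymm)
    (h : SatisfiesBAR Γ R r π ν) {H H' H'' : ℝ → ℝ} (cH : ContDiff ℝ 2 H)
    (hH : ∀ x, HasDerivAt H (H' x) x) (hH' : ∀ x, HasDerivAt H' (H'' x) x)
    (bH : ∀ x, |H x| ≤ 1) (bH' : ∀ x, |H' x| ≤ 1) (bH'' : ∀ x, |H'' x| ≤ 1) (α β : ℝ) :
    (1 / 2) * (Γ 0 0 * α ^ 2 + 2 * Γ 0 1 * α * β + Γ 1 1 * β ^ 2) *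
        (∫ z, H'' (α * z 0 + β * z 1) ∂π)
      + r * (R 0 0 * α + R 1 0 * β) *
        ((∫ z, H' (α * z 0 + β * z 1) ∂(ν 0)) - ∫ z, H' (α * z 0 + β * z 1) ∂π)
      + r ^ 2 * (R 0 1 * α + R 1 1 * β) *
        ((∫ z, H' (α * z 0 + β * z 1) ∂(ν 1)) - ∫ z, H' (α * z 0 + β * z 1) ∂π) = 0 := by
  have hb {K : ℝ → ℝ} (hK : ∀ x, |K x| ≤ 1) (c : ℝ) :
      OrthantBounded fun z => c * K (α * z 0 + β * z 1) := by
    refine ⟨|c|, fun z _ => ?_⟩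
    rw [abs_mul]
    exact mul_le_of_le_one_right (abs_nonneg c) (hK _)
  have h1 := hasGradient2_ridge hH' (1 * β) α β
  have h01 : (fun z : Fin 2 → ℝ => 1 * β * α * H'' (α * z 0 + β * z 1)) =
      fun z => 1 * α * β * H'' (α * z 0 + β * z 1) := by funext z; ring
  rw [h01] at h1
  have key := h.eq_two_dim hΓ (f := fun z => 1 * H (α * z 0 + β * z 1)) (by fun_prop)
    (hasGradient2_ridge hH 1 α β) (hasGradient2_ridge hH' (1 * α) α β) h1 (hb bH _) (hb bH' _)
    (hb bH' _) (hb bH'' _) (hb bH'' _) (hb bH'' _)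
  simp only [← mul_assoc, ← add_mul, integral_const_mul] at key
  linear_combination key

lemma charFun₂_eq {μ : Measure (Fin 2 → ℝ)} [IsProbabilityMeasure μ] (α β : ℝ) :
    charFun₂ μ α β =
      ((∫ z, Real.cos (α * z 0 + β * z 1) ∂μ : ℝ) : ℂ) +
        ((∫ z, Real.sin (α * z 0 + β * z 1) ∂μ : ℝ) : ℂ) * Complex.I := by
  have hc : Integrable (fun z : Fin 2 → ℝ => Real.cos (α * z 0 + β * z 1)) μ :=
    Integrable.of_bound (by fun_prop) 1 (ae_of_all _ fun z => Real.abs_cos_le_one _)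
  have hs : Integrable (fun z : Fin 2 → ℝ => Real.sin (α * z 0 + β * z 1)) μ :=
    Integrable.of_bound (by fun_prop) 1 (ae_of_all _ fun z => Real.abs_sin_le_one _)
  rw [charFun₂, ← integral_complex_ofReal, ← integral_complex_ofReal, ← integral_mul_const,
    ← integral_add hc.ofReal (hs.ofReal.mul_const _)]
  refine integral_congr_ae (ae_of_all _ fun z => ?_)
  simp only [Complex.exp_mul_I, Complex.ofReal_cos, Complex.ofReal_sin]

/-- The characteristic-function form of the basic adjoint relationship. -/
lemma SatisfiesBAR.eq_cexp {Γ R : Matrix (Fin 2) (Fin 2) ℝ} {r : ℝ}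
    {π : Measure (Fin 2 → ℝ)} {ν : Fin 2 → Measure (Fin 2 → ℝ)} (hΓ : Γ.IsSymm)
    (h : SatisfiesBAR Γ R r π ν) [IsProbabilityMeasure π] [∀ i, IsProbabilityMeasure (ν i)]
    (α β : ℝ) :
    ((1 / 2 * (Γ 0 0 * α ^ 2 + 2 * Γ 0 1 * α * β + Γ 1 1 * β ^ 2) : ℝ) : ℂ) *
        charFun₂ π α β
      + Complex.I * ((r * (R 0 0 * α + R 1 0 * β) : ℝ) : ℂ) *
        (charFun₂ π α β - charFun₂ (ν 0) α β)
      + Complex.I * ((r ^ 2 * (R 0 1 * α + R 1 1 * β) : ℝ) : ℂ) *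
        (charFun₂ π α β - charFun₂ (ν 1) α β) = 0 := by
  have hc := h.eq_ridge hΓ Real.contDiff_cos (fun x => Real.hasDerivAt_cos x)
    (fun x => (Real.hasDerivAt_sin x).neg) Real.abs_cos_le_one
    (fun x => by simpa using Real.abs_sin_le_one x)
    (fun x => by simpa using Real.abs_cos_le_one x) α β
  have hs := h.eq_ridge hΓ Real.contDiff_sin (fun x => Real.hasDerivAt_sin x)
    (fun x => Real.hasDerivAt_cos x) Real.abs_sin_le_one Real.abs_cos_le_one
    (fun x => by simpa using Real.abs_sin_le_one x) α β
  simp only [integral_neg] at hc hs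
  simp only [charFun₂_eq]
  have hc' := congrArg (fun x : ℝ => (x : ℂ)) hc
  have hs' := congrArg (fun x : ℝ => (x : ℂ)) hs
  push_cast at hc' hs' ⊢
  linear_combination -hc' - Complex.I * hs' +
    (r * (R 0 0 * α + R 1 0 * β) * ((∫ z, Real.sin (α * z 0 + β * z 1) ∂π : ℝ) -
        (∫ z, Real.sin (α * z 0 + β * z 1) ∂(ν 0) : ℝ)) +
      r ^ 2 * (R 0 1 * α + R 1 1 * β) * ((∫ z, Real.sin (α * z 0 + β * z 1) ∂π : ℝ) -
        (∫ z, Real.sin (α * z 0 + β * z 1) ∂(ν 1) : ℝ))) * Complex.I_sq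

/-- The function `(a + b x + c x²) e^{-δ x}`. -/
def polyExp (δ a b c x : ℝ) : ℝ := (a + b * x + c * x ^ 2) * Real.exp (-(δ * x))

@[fun_prop]
lemma contDiff_polyExp (δ a b c : ℝ) {n : WithTop ℕ∞} : ContDiff ℝ n (polyExp δ a b c) := by
  unfold polyExp
  fun_prop

@[fun_prop]
lemma continuous_polyExp (δ a b c : ℝ) : Continuous (polyExp δ a b c) :=
  (contDiff_polyExp δ a b c (n := 0)).continuous

lemma hasDerivAt_polyExp {δ a b c a' b' c' : ℝ} (ha : a' = b - δ * a) (hb : b' = 2 * c - δ * b)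
    (hc : c' = -(δ * c)) (x : ℝ) :
    HasDerivAt (polyExp δ a b c) (polyExp δ a' b' c' x) x := by
  have h1 : HasDerivAt (fun x : ℝ => a + b * x + c * x ^ 2) (b + c * (2 * x)) x := by
    refine ((((hasDerivAt_id x).const_mul b).const_add a).add
      ((hasDerivAt_pow 2 x).const_mul c)).congr_deriv ?_
    simp
  have h2 : HasDerivAt (fun x : ℝ => Real.exp (-(δ * x))) (Real.exp (-(δ * x)) * -δ) x := by
    simpa using ((hasDerivAt_id x).const_mul δ).neg.exp
  refine (h1.mul h2).congr_deriv ?_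
  rw [polyExp, ha, hb, hc]
  ring

lemma hasDerivAt_polyExp_comp_mul {δ a b c a' b' c' : ℝ} (ha : a' = b - δ * a)
    (hb : b' = 2 * c - δ * b) (hc : c' = -(δ * c)) (k r x : ℝ) :
    HasDerivAt (fun x => k * polyExp δ a b c (r * x)) (k * r * polyExp δ a' b' c' (r * x)) x := by
  have h1 : HasDerivAt (fun x : ℝ => r * x) r x := by
    simpa using (hasDerivAt_id x).const_mul r
  refine (((hasDerivAt_polyExp ha hb hc (r * x)).comp x h1).const_mul k).congr_deriv ?_
  ring

lemma exists_abs_polyExp_le {δ : ℝ} (hδ : 0 < δ) (a b c : ℝ) :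
    ∃ C, ∀ x, 0 ≤ x → |polyExp δ a b c x| ≤ C := by
  refine ⟨|a| + |b| * (1 / δ) + |c| * (2 / δ ^ 2), fun x hx => ?_⟩
  have he : 0 < Real.exp (-(δ * x)) := Real.exp_pos _
  have hmul : Real.exp (δ * x) * Real.exp (-(δ * x)) = 1 := by rw [← Real.exp_add]; simp
  have e0 : Real.exp (-(δ * x)) ≤ 1 := Real.exp_le_one_iff.2 (by nlinarith)
  have e1 : x * Real.exp (-(δ * x)) ≤ 1 / δ := by
    rw [le_div_iff₀ hδ]
    have := Real.add_one_le_exp (δ * x)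
    nlinarith
  have e2 : x ^ 2 * Real.exp (-(δ * x)) ≤ 2 / δ ^ 2 := by
    rw [le_div_iff₀ (by positivity)]
    have := Real.pow_div_factorial_le_exp (δ * x) (by positivity) 2
    norm_num at this
    nlinarith
  rw [polyExp]
  calc |(a + b * x + c * x ^ 2) * Real.exp (-(δ * x))|
      = |a * Real.exp (-(δ * x)) + b * (x * Real.exp (-(δ * x)))
          + c * (x ^ 2 * Real.exp (-(δ * x)))| := by ring_nf
    _ ≤ |a * Real.exp (-(δ * x))| + |b * (x * Real.exp (-(δ * x)))|
          + |c * (x ^ 2 * Real.exp (-(δ * x)))| := abs_add_three _ _ _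
    _ = |a| * Real.exp (-(δ * x)) + |b| * (x * Real.exp (-(δ * x)))
          + |c| * (x ^ 2 * Real.exp (-(δ * x))) := by
        rw [abs_mul a, abs_mul b, abs_mul c, abs_of_pos he,
          abs_of_nonneg (by positivity : 0 ≤ x * Real.exp (-(δ * x))),
          abs_of_nonneg (by positivity : 0 ≤ x ^ 2 * Real.exp (-(δ * x)))]
    _ ≤ |a| * 1 + |b| * (1 / δ) + |c| * (2 / δ ^ 2) := by gcongr
    _ = _ := by ring

lemma exists_abs_mul_polyExp_comp_le {δ r : ℝ} (hδ : 0 < δ) (hr : 0 ≤ r) (a b c k : ℝ) :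
    ∃ C, ∀ x, 0 ≤ x → |k * polyExp δ a b c (r * x)| ≤ C := by
  obtain ⟨C, hC⟩ := exists_abs_polyExp_le hδ a b c
  refine ⟨|k| * C, fun x hx => ?_⟩
  rw [abs_mul]
  exact mul_le_mul_of_nonneg_left (hC _ (by positivity)) (abs_nonneg k)

lemma polyExp_sq_nonneg (δ x : ℝ) : 0 ≤ polyExp δ 0 0 1 x := by
  rw [polyExp]
  have := Real.exp_pos (-(δ * x))
  have : 0 ≤ 0 + 0 * x + 1 * x ^ 2 := by nlinarith
  positivity

/-- The first derivative of `x² e^{-δ x}` is dominated by the function itself up to a constant. -/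
lemma abs_deriv_polyExp_sq_le {δ ε x : ℝ} (hδ : 0 < δ) (hε : 0 < ε) (hδε : 6 * δ ≤ ε)
    (hx : 0 ≤ x) :
    |polyExp δ 0 2 (-δ) x| ≤ ε * polyExp δ 0 0 1 x + (4 + 2 / ε) := by
  have he : 0 < Real.exp (-(δ * x)) := Real.exp_pos _
  have e0 : Real.exp (-(δ * x)) ≤ 1 := Real.exp_le_one_iff.2 (by nlinarith)
  have h1 : |0 + 2 * x + -δ * x ^ 2| ≤ ε * x ^ 2 + (4 + 2 / ε) := by
    have h2 : 2 * x ≤ ε / 2 * x ^ 2 + 2 / ε := by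
      have h3 : ε / 2 * x ^ 2 + 2 / ε - 2 * x = (ε * x - 2) ^ 2 / (2 * ε) := by field_simp; ring
      have : 0 ≤ (ε * x - 2) ^ 2 / (2 * ε) := by positivity
      linarith
    have h4 : 0 ≤ 2 / ε := by positivity
    have h5 : 6 * δ * x ^ 2 ≤ ε * x ^ 2 := by gcongr
    have h6 : 0 ≤ δ * x ^ 2 := by positivity
    rw [abs_le]
    constructor <;> linarith
  have h2 : 0 ≤ 4 + 2 / ε := by positivity
  rw [polyExp, polyExp, abs_mul, abs_of_pos he]
  nlinarith [mul_le_mul_of_nonneg_right h1 he.le, mul_le_mul_of_nonneg_left e0 h2]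

/-- The second derivative of `x² e^{-δ x}` is dominated by the function itself up to a constant. -/
lemma abs_deriv2_polyExp_sq_le {δ ε x : ℝ} (hδ : 0 < δ) (hδ1 : δ ≤ 1) (hε : 0 < ε)
    (hδε : 6 * δ ≤ ε) (hx : 0 ≤ x) :
    |polyExp δ 2 (-4 * δ) (δ ^ 2) x| ≤ ε * polyExp δ 0 0 1 x + (4 + 2 / ε) := by
  have he : 0 < Real.exp (-(δ * x)) := Real.exp_pos _
  have e0 : Real.exp (-(δ * x)) ≤ 1 := Real.exp_le_one_iff.2 (by nlinarith)
  have h1 : |2 + -4 * δ * x + δ ^ 2 * x ^ 2| ≤ ε * x ^ 2 + (4 + 2 / ε) := by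
    have h2 : 0 ≤ δ * (x - 1) ^ 2 := by positivity
    have h4 : 0 ≤ 2 / ε := by positivity
    have h5 : 6 * δ * x ^ 2 ≤ ε * x ^ 2 := by gcongr
    have h6 : 0 ≤ δ * x ^ 2 := by positivity
    have h7 : δ ^ 2 * x ^ 2 ≤ δ * x ^ 2 := by nlinarith [sq_nonneg x]
    have h8 : 0 ≤ δ ^ 2 * x ^ 2 := by positivity
    have h9 : 0 ≤ δ * x := by positivity
    rw [abs_le]
    constructor <;> nlinarith
  have h2 : 0 ≤ 4 + 2 / ε := by positivity
  rw [polyExp, polyExp, abs_mul, abs_of_pos he]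
  nlinarith [mul_le_mul_of_nonneg_right h1 he.le, mul_le_mul_of_nonneg_left e0 h2]

lemma OrthantBounded.integrable {f : (Fin 2 → ℝ) → ℝ} (hf : OrthantBounded f) (hc : Continuous f)
    {μ : Measure (Fin 2 → ℝ)} [IsFiniteMeasure μ] (hμ : ∀ᵐ z ∂μ, z ∈ posOrthant 2) :
    Integrable f μ := by
  obtain ⟨C, hC⟩ := hf
  exact Integrable.of_bound hc.aestronglyMeasurable C (hμ.mono hC)

lemma integrable_polyExp {δ r : ℝ} (hδ : 0 < δ) (hr : 0 ≤ r) (a b c : ℝ)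
    {μ : Measure (Fin 2 → ℝ)} [IsFiniteMeasure μ] (hμ : ∀ᵐ z ∂μ, z ∈ posOrthant 2) :
    Integrable (fun z => polyExp δ a b c (r * z 0)) μ := by
  obtain ⟨C, hC⟩ := exists_abs_polyExp_le hδ a b c
  exact OrthantBounded.integrable ⟨C, fun z hz => hC _ (mul_nonneg hr (hz 0))⟩ (by fun_prop) hμ

/-- The balance equation for functions of the first coordinate only. -/
lemma SatisfiesBAR.first_coordinate_le {Γ R : Matrix (Fin 2) (Fin 2) ℝ} {r : ℝ}
    {π : Measure (Fin 2 → ℝ)} {ν : Fin 2 → Measure (Fin 2 → ℝ)} (hΓ : Γ.IsSymm)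
    (hΓ0 : 0 < Γ 0 0) (h : SatisfiesBAR Γ R r π ν) [IsProbabilityMeasure π] (hr : 0 < r)
    (hπ : ∀ᵐ z ∂π, z ∈ posOrthant 2) (hν0 : ∀ᵐ z ∂(ν 0), z 0 = 0)
    {δ ε : ℝ} (hδ : 0 < δ) (hε : 0 < ε) (hδε : 6 * δ ≤ ε) :
    (R 0 0 + r * R 0 1) * (∫ z, polyExp δ 0 0 1 (r * z 0) ∂π)
      - r * R 0 1 * (∫ z, polyExp δ 0 0 1 (r * z 0) ∂(ν 1)) ≤
    1 / 2 * Γ 0 0 * (ε * (∫ z, polyExp δ 0 0 1 (r * z 0) ∂π) + (4 + 2 / ε)) := by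
  obtain ⟨C, hC⟩ := exists_abs_mul_polyExp_comp_le hδ hr.le (-(2 / δ ^ 3)) (-(2 / δ ^ 2)) (-(1 / δ)) 1
  obtain ⟨C', hC'⟩ := exists_abs_mul_polyExp_comp_le hδ hr.le 0 0 1 (1 * r)
  obtain ⟨C'', hC''⟩ := exists_abs_mul_polyExp_comp_le hδ hr.le 0 2 (-δ) (1 * r * r)
  have key := h.eq_mul hΓ
    (A := fun x => 1 * polyExp δ (-(2 / δ ^ 3)) (-(2 / δ ^ 2)) (-(1 / δ)) (r * x))
    (A' := fun x => 1 * r * polyExp δ 0 0 1 (r * x))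
    (A'' := fun x => 1 * r * r * polyExp δ 0 2 (-δ) (r * x))
    (B := fun _ => 1) (B' := fun _ => 0) (B'' := fun _ => 0)
    (by fun_prop) (by fun_prop)
    (hasDerivAt_polyExp_comp_mul (by field_simp; ring) (by field_simp; ring) (by field_simp) _ _)
    (hasDerivAt_polyExp_comp_mul (by ring) (by ring) (by ring) _ _)
    (fun x => hasDerivAt_const x _) (fun x => hasDerivAt_const x _) hC hC' hC''
    (fun x _ => le_refl _) (fun x _ => le_refl _) (fun x _ => le_refl _)
  have hz : ∫ z, polyExp δ 0 0 1 (r * z 0) ∂(ν 0) = 0 := by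
    rw [← integral_zero (Fin 2 → ℝ) ℝ (μ := ν 0)]
    refine integral_congr_ae (hν0.mono fun z hz => ?_)
    simp [hz, polyExp]
  simp only [mul_zero, mul_one, one_mul, add_zero, ← mul_assoc, integral_const_mul, hz] at key
  have hle : ∫ z, polyExp δ 0 2 (-δ) (r * z 0) ∂π ≤
      ε * (∫ z, polyExp δ 0 0 1 (r * z 0) ∂π) + (4 + 2 / ε) := by
    have hi := integrable_polyExp hδ hr.le 0 0 1 hπ
    calc ∫ z, polyExp δ 0 2 (-δ) (r * z 0) ∂π
        ≤ ∫ z, (ε * polyExp δ 0 0 1 (r * z 0) + (4 + 2 / ε)) ∂π := by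
          refine integral_mono_ae (integrable_polyExp hδ hr.le _ _ _ hπ)
            ((hi.const_mul ε).add (integrable_const _)) (hπ.mono fun z hz => ?_)
          exact (le_abs_self _).trans
            (abs_deriv_polyExp_sq_le hδ hε hδε (mul_nonneg hr.le (hz 0)))
      _ = _ := by
          rw [integral_add (hi.const_mul ε) (integrable_const _), integral_const_mul]
          simp
  have h2 : (R 0 0 + r * R 0 1) * (∫ z, polyExp δ 0 0 1 (r * z 0) ∂π)
      - r * R 0 1 * (∫ z, polyExp δ 0 0 1 (r * z 0) ∂(ν 1)) =
      1 / 2 * Γ 0 0 * ∫ z, polyExp δ 0 2 (-δ) (r * z 0) ∂π := by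
    have hr2 : r ^ 2 ≠ 0 := by positivity
    refine mul_left_cancel₀ hr2 ?_
    linear_combination -key
  rw [h2]
  gcongr

/-- A bound on boundary moments under `ν 1` in terms of interior moments. -/
lemma SatisfiesBAR.second_boundary_le {Γ R : Matrix (Fin 2) (Fin 2) ℝ} {r : ℝ}
    {π : Measure (Fin 2 → ℝ)} {ν : Fin 2 → Measure (Fin 2 → ℝ)} (hΓ : Γ.IsSymm)
    (hΓ1 : 0 < Γ 1 1) (hR1 : 0 < R 1 1)
    (h : SatisfiesBAR Γ R r π ν) [IsProbabilityMeasure π] (hr : 0 < r) (hr1 : r < 1)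
    (hπ : ∀ᵐ z ∂π, z ∈ posOrthant 2) (hν0 : ∀ᵐ z ∂(ν 0), z 0 = 0)
    (hν1 : ∀ᵐ z ∂(ν 1), z 1 = 0)
    {δ ε a : ℝ} (ha : 0 < a) (hδ : 0 < δ) (hδ1 : δ ≤ 1) (hε : 0 < ε) (hδε : 6 * δ ≤ ε) :
    r * R 1 1 * (∫ z, polyExp δ 0 0 1 (r * z 0) ∂(ν 1)) ≤
    (1 / 2 * |Γ 0 0| / a + |Γ 0 1| + (|R 0 0| + |R 0 1|) / a) *
        (ε * (∫ z, polyExp δ 0 0 1 (r * z 0) ∂π) + (4 + 2 / ε))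
      + (1 / 2 * Γ 1 1 * a + max (R 1 0) 0 + r * R 1 1) *
        (∫ z, polyExp δ 0 0 1 (r * z 0) ∂π) := by
  set κ := a * r with hκ
  have hκ0 : 0 < κ := by positivity
  obtain ⟨C, hC⟩ := exists_abs_mul_polyExp_comp_le hδ hr.le 0 0 1 1
  obtain ⟨C', hC'⟩ := exists_abs_mul_polyExp_comp_le hδ hr.le 0 2 (-δ) (1 * r)
  obtain ⟨C'', hC''⟩ := exists_abs_mul_polyExp_comp_le hδ hr.le 2 (-4 * δ) (δ ^ 2) (1 * r * r)
  have hE (x : ℝ) (hx : 0 ≤ x) : 0 < Real.exp (-(κ * x)) ∧ Real.exp (-(κ * x)) ≤ 1 :=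
    ⟨Real.exp_pos _, Real.exp_le_one_iff.2 (by nlinarith)⟩
  have hexp (x : ℝ) : HasDerivAt (fun x : ℝ => Real.exp (-(κ * x))) (-κ * Real.exp (-(κ * x))) x := by
    simpa [mul_comm] using ((hasDerivAt_id x).const_mul κ).neg.exp
  have bB (x : ℝ) (hx : 0 ≤ x) : |1 - Real.exp (-(κ * x))| ≤ 1 := by
    obtain ⟨h1, h2⟩ := hE x hx
    rw [abs_le]; constructor <;> linarith
  have bB' (x : ℝ) (hx : 0 ≤ x) : |κ * Real.exp (-(κ * x))| ≤ κ := by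
    obtain ⟨h1, h2⟩ := hE x hx
    rw [abs_of_pos (by positivity)]
    nlinarith
  have bB'' (x : ℝ) (hx : 0 ≤ x) : |-(κ ^ 2) * Real.exp (-(κ * x))| ≤ κ ^ 2 := by
    obtain ⟨h1, h2⟩ := hE x hx
    rw [abs_mul, abs_neg, abs_of_pos (by positivity : 0 < κ ^ 2), abs_of_pos h1]
    nlinarith [sq_nonneg κ]
  have key := h.eq_mul hΓ
    (A := fun x => 1 * polyExp δ 0 0 1 (r * x))
    (A' := fun x => 1 * r * polyExp δ 0 2 (-δ) (r * x))
    (A'' := fun x => 1 * r * r * polyExp δ 2 (-4 * δ) (δ ^ 2) (r * x))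
    (B := fun y => 1 - Real.exp (-(κ * y))) (B' := fun y => κ * Real.exp (-(κ * y)))
    (B'' := fun y => -(κ ^ 2) * Real.exp (-(κ * y)))
    (by fun_prop) (by fun_prop)
    (hasDerivAt_polyExp_comp_mul (by ring) (by ring) (by ring) _ _)
    (hasDerivAt_polyExp_comp_mul (by ring) (by ring) (by ring) _ _)
    (fun x => ((hexp x).const_sub 1).congr_deriv (by ring))
    (fun x => ((hexp x).const_mul κ).congr_deriv (by ring)) hC hC' hC'' bB bB' bB''
  have i1 := (orthantBounded_mul hC'' bB).integrable (by fun_prop) hπ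
  have i2 := (orthantBounded_mul hC' bB').integrable (by fun_prop) hπ
  have i3 := (orthantBounded_mul hC bB'').integrable (by fun_prop) hπ
  have i4 := (orthantBounded_mul hC' bB).integrable (by fun_prop) hπ
  have i5 := (orthantBounded_mul hC bB').integrable (by fun_prop) hπ
  have z0 : ∀ c d : ℝ, ∫ z : Fin 2 → ℝ, (c * ((1 * r * polyExp δ 0 2 (-δ) (r * z 0)) *
      (1 - Real.exp (-(κ * z 1)))) + d * ((1 * polyExp δ 0 0 1 (r * z 0)) *
      (κ * Real.exp (-(κ * z 1))))) ∂(ν 0) = 0 := by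
    intro c d
    rw [← integral_zero (Fin 2 → ℝ) ℝ (μ := ν 0)]
    refine integral_congr_ae (hν0.mono fun z hz => ?_)
    simp [hz, polyExp]
  have z1 : ∀ c d : ℝ, ∫ z : Fin 2 → ℝ, (c * ((1 * r * polyExp δ 0 2 (-δ) (r * z 0)) *
      (1 - Real.exp (-(κ * z 1)))) + d * ((1 * polyExp δ 0 0 1 (r * z 0)) *
      (κ * Real.exp (-(κ * z 1))))) ∂(ν 1) =
      d * κ * ∫ z, polyExp δ 0 0 1 (r * z 0) ∂(ν 1) := by
    intro c d
    rw [← integral_const_mul]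
    refine integral_congr_ae (hν1.mono fun z hz => ?_)
    simp [hz]
    ring
  have add2 {f g : (Fin 2 → ℝ) → ℝ} (hf : Integrable f π) (hg : Integrable g π) (c d : ℝ) :
      ∫ z, (c * f z + d * g z) ∂π = c * (∫ z, f z ∂π) + d * ∫ z, g z ∂π := by
    rw [integral_add (hf.const_mul c) (hg.const_mul d), integral_const_mul, integral_const_mul]
  have add3 {f g k : (Fin 2 → ℝ) → ℝ} (hf : Integrable f π) (hg : Integrable g π)
      (hk : Integrable k π) (c d e : ℝ) :
      ∫ z, (c * f z + d * g z + e * k z) ∂π =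
        c * (∫ z, f z ∂π) + d * (∫ z, g z ∂π) + e * ∫ z, k z ∂π := by
    rw [← add2 hf hg, ← integral_const_mul]
    exact integral_add ((hf.const_mul c).add (hg.const_mul d)) (hk.const_mul e)
  rw [z0, z1, add3 i1 i2 i3, add2 i4 i5, add2 i4 i5] at key
  have i0 := integrable_polyExp hδ hr.le 0 0 1 hπ
  have hdom {f : (Fin 2 → ℝ) → ℝ} (hf : Integrable f π) {k l C₀ : ℝ}
      (hb : ∀ z ∈ posOrthant 2, |f z| ≤ k * (l * polyExp δ 0 0 1 (r * z 0) + C₀)) :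
      |∫ z, f z ∂π| ≤ k * (l * (∫ z, polyExp δ 0 0 1 (r * z 0) ∂π) + C₀) := by
    calc |∫ z, f z ∂π| ≤ ∫ z, |f z| ∂π := abs_integral_le_integral_abs
      _ ≤ ∫ z, k * (l * polyExp δ 0 0 1 (r * z 0) + C₀) ∂π :=
          integral_mono_ae hf.abs (((i0.const_mul l).add (integrable_const C₀)).const_mul k)
            (hπ.mono hb)
      _ = _ := by
          rw [integral_const_mul, integral_add (i0.const_mul l) (integrable_const _),
            integral_const_mul]
          simp
  have hX {z : Fin 2 → ℝ} (hz : z ∈ posOrthant 2) : 0 ≤ r * z 0 := mul_nonneg hr.le (hz 0)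
  have hD1 {z : Fin 2 → ℝ} (hz : z ∈ posOrthant 2) := abs_deriv_polyExp_sq_le hδ hε hδε (hX hz)
  have hD2 {z : Fin 2 → ℝ} (hz : z ∈ posOrthant 2) :=
    abs_deriv2_polyExp_sq_le hδ hδ1 hε hδε (hX hz)
  have b1 := hdom i1 (k := r ^ 2) (l := ε) (C₀ := 4 + 2 / ε) fun z hz => by
    rw [abs_mul, abs_mul, abs_of_pos (by positivity : 0 < 1 * r * r)]
    nlinarith [mul_le_mul (mul_le_mul_of_nonneg_left (hD2 hz) (by positivity : 0 ≤ r ^ 2))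
      (bB _ (hz 1)) (abs_nonneg _) (mul_nonneg (by positivity) ((abs_nonneg _).trans (hD2 hz)))]
  have b2 := hdom i2 (k := r * κ) (l := ε) (C₀ := 4 + 2 / ε) fun z hz => by
    rw [abs_mul, abs_mul, abs_of_pos (by positivity : 0 < 1 * r)]
    nlinarith [mul_le_mul (mul_le_mul_of_nonneg_left (hD1 hz) hr.le)
      (bB' _ (hz 1)) (abs_nonneg _) (mul_nonneg (by positivity) ((abs_nonneg _).trans (hD1 hz)))]
  have b3 := hdom i3 (k := κ ^ 2) (l := 1) (C₀ := 0) fun z hz => by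
    have h0 := polyExp_sq_nonneg δ (r * z 0)
    rw [abs_mul, one_mul, add_zero, abs_of_nonneg h0, mul_comm]
    exact mul_le_mul_of_nonneg_right (bB'' _ (hz 1)) h0
  have b4 := hdom i4 (k := r) (l := ε) (C₀ := 4 + 2 / ε) fun z hz => by
    rw [abs_mul, abs_mul, abs_of_pos (by positivity : 0 < 1 * r)]
    nlinarith [mul_le_mul (mul_le_mul_of_nonneg_left (hD1 hz) hr.le)
      (bB _ (hz 1)) (abs_nonneg _) (mul_nonneg (by positivity) ((abs_nonneg _).trans (hD1 hz)))]
  have b5 := hdom i5 (k := κ) (l := 1) (C₀ := 0) fun z hz => by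
    have h0 := polyExp_sq_nonneg δ (r * z 0)
    rw [abs_mul, one_mul, add_zero, abs_of_nonneg h0, mul_comm]
    exact mul_le_mul_of_nonneg_right (bB' _ (hz 1)) h0
  have p5 : 0 ≤ ∫ z, 1 * polyExp δ 0 0 1 (r * z 0) * (κ * Real.exp (-(κ * z 1))) ∂π :=
    integral_nonneg fun z => by
      have h0 := polyExp_sq_nonneg δ (r * z 0)
      positivity
  have pN : 0 ≤ ∫ z, polyExp δ 0 0 1 (r * z 0) ∂π :=
    integral_nonneg fun z => polyExp_sq_nonneg δ (r * z 0)
  rw [one_mul, add_zero] at b3 b5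
  have pD : 0 ≤ ε * (∫ z, polyExp δ 0 0 1 (r * z 0) ∂π) + (4 + 2 / ε) := by positivity
  generalize (∫ z, 1 * r * r * polyExp δ 2 (-4 * δ) (δ ^ 2) (r * z 0)
    * (1 - Real.exp (-(κ * z 1))) ∂π) = J1 at *
  generalize (∫ z, 1 * r * polyExp δ 0 2 (-δ) (r * z 0)
    * (κ * Real.exp (-(κ * z 1))) ∂π) = J2 at *
  generalize (∫ z, 1 * polyExp δ 0 0 1 (r * z 0)
    * (-(κ ^ 2) * Real.exp (-(κ * z 1))) ∂π) = J3 at *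
  generalize (∫ z, 1 * r * polyExp δ 0 2 (-δ) (r * z 0)
    * (1 - Real.exp (-(κ * z 1))) ∂π) = J4 at *
  generalize (∫ z, 1 * polyExp δ 0 0 1 (r * z 0)
    * (κ * Real.exp (-(κ * z 1))) ∂π) = J5 at *
  generalize (∫ z, polyExp δ 0 0 1 (r * z 0) ∂(ν 1)) = M at *
  generalize (∫ z, polyExp δ 0 0 1 (r * z 0) ∂π) = N at *
  generalize ε * N + (4 + 2 / ε) = D at *
  have abs_le {x y k : ℝ} (hy : |y| ≤ k) : x * y ≤ |x| * k :=
    (le_abs_self _).trans ((abs_mul x y).le.trans (mul_le_mul_of_nonneg_left hy (abs_nonneg x)))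
  have c1 := abs_le (x := -Γ 0 0) b1
  have c2 := abs_le (x := -Γ 0 1) b2
  have c3 := abs_le (x := -Γ 1 1) b3
  have c4 := abs_le (x := R 0 0) b4
  have c4' := abs_le (x := R 0 1) b4
  rw [abs_of_nonneg p5] at b5
  rw [abs_neg] at c1 c2 c3
  rw [abs_of_pos hΓ1] at c3
  have c5 : R 1 0 * J5 ≤ max (R 1 0) 0 * (κ * N) :=
    mul_le_mul (le_max_left _ _) b5 p5 (le_max_right _ _)
  have c6 : R 1 1 * J5 ≤ R 1 1 * (κ * N) := mul_le_mul_of_nonneg_left b5 hR1.le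
  have c7 : r ^ 2 * (|R 0 1| * (r * D)) ≤ r * (|R 0 1| * (r * D)) :=
    mul_le_mul_of_nonneg_right (by nlinarith) (by positivity)
  have c8 := mul_le_mul_of_nonneg_left c4 hr.le
  have c9 := mul_le_mul_of_nonneg_left c4' (by positivity : 0 ≤ r ^ 2)
  have c10 := mul_le_mul_of_nonneg_left c5 hr.le
  have c11 := mul_le_mul_of_nonneg_left c6 (by positivity : 0 ≤ r ^ 2)
  have hra : 0 < r ^ 2 * a := by positivity
  refine le_of_mul_le_mul_left ?_ hra
  have e : r ^ 2 * a * ((1 / 2 * |Γ 0 0| / a + |Γ 0 1| + (|R 0 0| + |R 0 1|) / a) * D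
      + (1 / 2 * Γ 1 1 * a + max (R 1 0) 0 + r * R 1 1) * N) =
      1 / 2 * (|Γ 0 0| * (r ^ 2 * D)) + |Γ 0 1| * (r * κ * D) + r * (|R 0 0| * (r * D))
      + r * (|R 0 1| * (r * D)) + 1 / 2 * (Γ 1 1 * (κ ^ 2 * N)) + r * (max (R 1 0) 0 * (κ * N))
      + r ^ 2 * (R 1 1 * (κ * N)) := by
    rw [hκ]
    field_simp
    ring
  rw [e]
  have e' : r ^ 2 * a * (r * R 1 1 * M) = r ^ 2 * (R 1 1 * κ * M) := by rw [hκ]; ring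
  rw [e']
  linarith

lemma mul_max_zero_lt {a b c d : ℝ} (ha : 0 < a) (hd : 0 < d) (h : 0 < a * d - b * c) :
    max b 0 * max c 0 < a * d := by
  have := mul_pos ha hd
  rcases le_total b 0 with hb | hb
  · simpa [hb] using this
  rcases le_total c 0 with hc | hc
  · simpa [hc] using this
  rw [max_eq_left hb, max_eq_left hc]
  linarith

/-- Uniform bounds on the regularised second moments of the first coordinate. -/
lemma exists_polyExp_moment_bound {Γ R : Matrix (Fin 2) (Fin 2) ℝ} (hΓ : Γ.IsSymm)
    (hΓ0 : 0 < Γ 0 0) (hΓ1 : 0 < Γ 1 1) (hR0 : 0 < R 0 0) (hR1 : 0 < R 1 1)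
    (hdet : 0 < R 0 0 * R 1 1 - R 0 1 * R 1 0) :
    ∃ r₀ > 0, ∃ δ₀ > 0, ∃ K ≥ 0, ∀ r : ℝ, 0 < r → r < 1 → r < r₀ →
      ∀ (π : Measure (Fin 2 → ℝ)) (ν : Fin 2 → Measure (Fin 2 → ℝ)), IsProbabilityMeasure π →
      SatisfiesBAR Γ R r π ν → (∀ᵐ z ∂π, z ∈ posOrthant 2) → (∀ᵐ z ∂(ν 0), z 0 = 0) →
      (∀ᵐ z ∂(ν 1), z 1 = 0) → ∀ δ : ℝ, 0 < δ → δ ≤ δ₀ →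
      (∫ z, polyExp δ 0 0 1 (r * z 0) ∂π) ≤ K ∧
        r * (∫ z, polyExp δ 0 0 1 (r * z 0) ∂(ν 1)) ≤ K := by
  set m := max (R 1 0) 0 with hm
  have hm0 : 0 ≤ m := le_max_right _ _
  set c := max (R 0 1) 0 / R 1 1 with hc
  have hc0 : 0 ≤ c := div_nonneg (le_max_right _ _) hR1.le
  have hcR : c * R 1 1 = max (R 0 1) 0 := div_mul_cancel₀ _ hR1.ne'
  obtain ⟨κ, hκ⟩ : ∃ κ, κ = R 0 0 - c * m := ⟨_, rfl⟩
  have hκ0 : 0 < κ := by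
    have h := mul_max_zero_lt hR0 hR1 hdet
    rw [← hcR, ← hm] at h
    have : 0 < κ * R 1 1 := by rw [hκ]; nlinarith
    exact pos_of_mul_pos_left this hR1.le
  obtain ⟨a, ha⟩ : ∃ a, a = κ / (4 * (c * Γ 1 1 + 1)) := ⟨_, rfl⟩
  have ha0 : 0 < a := by rw [ha]; positivity
  have hca : 1 / 2 * c * Γ 1 1 * a ≤ κ / 4 := by
    have h : a * (4 * (c * Γ 1 1 + 1)) = κ := by rw [ha]; field_simp
    have : 0 ≤ c * Γ 1 1 * a := by positivity
    linarith
  obtain ⟨k, hk⟩ : ∃ k, k = 1 / 2 * |Γ 0 0| / a + |Γ 0 1| + (|R 0 0| + |R 0 1|) / a := ⟨_, rfl⟩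
  have hk0 : 0 ≤ k := by rw [hk]; positivity
  obtain ⟨L, hL⟩ : ∃ L, L = 1 / 2 * Γ 0 0 + c * k := ⟨_, rfl⟩
  have hL0 : 0 < L := by rw [hL]; positivity
  obtain ⟨ε, hε⟩ : ∃ ε, ε = κ / (4 * L) := ⟨_, rfl⟩
  have hε0 : 0 < ε := by rw [hε]; positivity
  have hLε : L * ε = κ / 4 := by rw [hε]; field_simp
  obtain ⟨C, hC⟩ : ∃ C, C = 4 + 2 / ε := ⟨_, rfl⟩
  have hC0 : 0 < C := by rw [hC]; positivity
  obtain ⟨K₁, hK₁⟩ : ∃ K₁, K₁ = 4 * L * C / κ := ⟨_, rfl⟩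
  have hK₁0 : 0 < K₁ := by rw [hK₁]; positivity
  set K₂ := (k * (ε * K₁ + C) + (1 / 2 * Γ 1 1 * a + m + R 1 1) * K₁) / R 1 1 with hK₂
  refine ⟨κ / (4 * (|R 0 1| + c * R 1 1 + 1)), by positivity, min 1 (ε / 6), by positivity,
    max K₁ K₂, hK₁0.le.trans (le_max_left _ _), ?_⟩
  intro r hr hr1 hr0 π ν hprob hB hπ hν0 hν1 δ hδ hδ0
  have hδ1 : δ ≤ 1 := hδ0.trans (min_le_left _ _)
  have hδε : 6 * δ ≤ ε := by linarith [hδ0.trans (min_le_right _ _)]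
  have h1 := hB.first_coordinate_le hΓ hΓ0 hr hπ hν0 hδ hε0 hδε
  have h2 := hB.second_boundary_le hΓ hΓ1 hR1 hr hr1 hπ hν0 hν1 ha0 hδ hδ1 hε0 hδε
  have hN : 0 ≤ ∫ z, polyExp δ 0 0 1 (r * z 0) ∂π :=
    integral_nonneg fun z => polyExp_sq_nonneg δ (r * z 0)
  have hM : 0 ≤ ∫ z, polyExp δ 0 0 1 (r * z 0) ∂(ν 1) :=
    integral_nonneg fun z => polyExp_sq_nonneg δ (r * z 0)
  rw [← hC] at h1 h2
  rw [← hk, ← hm] at h2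
  generalize (∫ z, polyExp δ 0 0 1 (r * z 0) ∂(ν 1)) = M at *
  generalize (∫ z, polyExp δ 0 0 1 (r * z 0) ∂π) = N at *
  have hrs : r * (|R 0 1| + c * R 1 1) ≤ κ / 4 := by
    rw [lt_div_iff₀ (by positivity)] at hr0
    linarith
  have h3 : r * R 0 1 * M ≤ c * (r * R 1 1 * M) := by
    have : R 0 1 * (r * M) ≤ c * R 1 1 * (r * M) := by
      rw [hcR]
      exact mul_le_mul_of_nonneg_right (le_max_left _ _) (by positivity)
    linarith
  have h4 := mul_le_mul_of_nonneg_left h2 hc0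
  have h5 : -(|R 0 1|) * (r * N) ≤ R 0 1 * (r * N) :=
    mul_le_mul_of_nonneg_right (neg_abs_le _) (by positivity)
  have h6 := mul_le_mul_of_nonneg_right hrs hN
  have h7 := mul_le_mul_of_nonneg_right hca hN
  have hNK : N ≤ K₁ := by
    rw [hK₁, le_div_iff₀ hκ0]
    have h8 : R 0 0 * N = κ * N + c * m * N := by rw [hκ]; ring
    have h9 : L * (ε * N) = κ / 4 * N := by rw [← hLε]; ring
    have h10 : L * (ε * N + C) = 1 / 2 * Γ 0 0 * (ε * N + C) + c * k * (ε * N + C) := by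
      rw [hL]; ring
    linarith
  refine ⟨hNK.trans (le_max_left _ _), le_trans ?_ (le_max_right _ _)⟩
  rw [hK₂, le_div_iff₀ hR1]
  calc r * M * R 1 1 = r * R 1 1 * M := by ring
    _ ≤ _ := h2
    _ ≤ k * (ε * K₁ + C) + (1 / 2 * Γ 1 1 * a + m + 1 * R 1 1) * K₁ := by gcongr
    _ = _ := by ring

lemma integrable_sq_of_polyExp_le {μ : Measure (Fin 2 → ℝ)} [IsFiniteMeasure μ]
    (hμ : ∀ᵐ z ∂μ, z ∈ posOrthant 2) {r δ₀ K : ℝ} (hr : 0 ≤ r) (hδ₀ : 0 < δ₀) (hK : 0 ≤ K)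
    (h : ∀ δ, 0 < δ → δ ≤ δ₀ → (∫ z, polyExp δ 0 0 1 (r * z 0) ∂μ) ≤ K) :
    Integrable (fun z => (r * z 0) ^ 2) μ ∧ ∫ z, (r * z 0) ^ 2 ∂μ ≤ K := by
  have hle : ∫⁻ z, ENNReal.ofReal ((r * z 0) ^ 2) ∂μ ≤ ENNReal.ofReal K := by
    have hδ (n : ℕ) : 0 < δ₀ / (n + 1) := by positivity
    have hlim : Tendsto (fun n : ℕ => δ₀ / ((n : ℝ) + 1)) atTop (nhds 0) := by
      simpa [div_eq_mul_inv] using tendsto_one_div_add_atTop_nhds_zero_nat.const_mul δ₀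
    calc ∫⁻ z, ENNReal.ofReal ((r * z 0) ^ 2) ∂μ
        = ∫⁻ z, liminf (fun n : ℕ =>
            ENNReal.ofReal (polyExp (δ₀ / (n + 1)) 0 0 1 (r * z 0))) atTop ∂μ := by
          refine lintegral_congr fun z => (Tendsto.liminf_eq ?_).symm
          refine ENNReal.tendsto_ofReal ?_
          have hc : Continuous fun δ : ℝ => polyExp δ 0 0 1 (r * z 0) := by
            unfold polyExp; fun_prop
          simpa [polyExp, Function.comp_def] using (hc.tendsto 0).comp hlim
      _ ≤ liminf (fun n : ℕ =>
            ∫⁻ z, ENNReal.ofReal (polyExp (δ₀ / (n + 1)) 0 0 1 (r * z 0)) ∂μ) atTop :=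
          lintegral_liminf_le fun n =>
            (Continuous.measurable (by fun_prop)).ennreal_ofReal
      _ ≤ ENNReal.ofReal K := by
          refine liminf_le_of_frequently_le' (Frequently.of_forall fun n => ?_)
          rw [← ofReal_integral_eq_lintegral_ofReal (integrable_polyExp (hδ n) hr 0 0 1 hμ)
            (ae_of_all _ fun z => polyExp_sq_nonneg _ _)]
          refine ENNReal.ofReal_le_ofReal (h _ (hδ n) ?_)
          rw [div_le_iff₀ (by positivity)]
          nlinarith [(Nat.cast_nonneg n : (0 : ℝ) ≤ n)]
  have hi : Integrable (fun z : Fin 2 → ℝ => (r * z 0) ^ 2) μ := by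
    refine ⟨Continuous.aestronglyMeasurable (by fun_prop), ?_⟩
    rw [hasFiniteIntegral_iff_ofReal (ae_of_all _ fun z => sq_nonneg _)]
    exact hle.trans_lt ENNReal.ofReal_lt_top
  refine ⟨hi, ?_⟩
  rw [← ENNReal.ofReal_le_ofReal_iff hK,
    ofReal_integral_eq_lintegral_ofReal hi (ae_of_all _ fun z => sq_nonneg _)]
  exact hle

lemma norm_charFun₂_sub_le {μ : Measure (Fin 2 → ℝ)} [IsProbabilityMeasure μ] {r K : ℝ}
    (hi : Integrable (fun z => (r * z 0) ^ 2) μ) (hK : ∫ z, (r * z 0) ^ 2 ∂μ ≤ K)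
    (k α β : ℝ) {η : ℝ} (hη : 0 < η) :
    ‖charFun₂ μ (α + k * r) β - charFun₂ μ α β‖ ≤ |k| * (η * K + 1 / η) := by
  have hint (α β : ℝ) :
      Integrable (fun z : Fin 2 → ℝ => Complex.exp ((α * z 0 + β * z 1 : ℝ) * Complex.I)) μ :=
    Integrable.of_bound (Continuous.aestronglyMeasurable (by fun_prop)) 1
      (ae_of_all _ fun z => (Complex.norm_exp_ofReal_mul_I _).le)
  rw [charFun₂, charFun₂, ← integral_sub (hint _ _) (hint _ _)]
  calc _ ≤ ∫ z, |k| * (η * (r * z 0) ^ 2 + 1 / η) ∂μ := by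
        refine norm_integral_le_of_norm_le
          (((hi.const_mul η).add (integrable_const _)).const_mul _) (ae_of_all _ fun z => ?_)
        have h1 : Complex.exp (((α + k * r) * z 0 + β * z 1 : ℝ) * Complex.I)
            - Complex.exp ((α * z 0 + β * z 1 : ℝ) * Complex.I) =
            Complex.exp ((α * z 0 + β * z 1 : ℝ) * Complex.I) *
              (Complex.exp (Complex.I * (k * (r * z 0) : ℝ)) - 1) := by
          rw [mul_sub, ← Complex.exp_add, mul_one]
          congr 2
          push_cast
          ring
        have h2 : |r * z 0| ≤ η * (r * z 0) ^ 2 + 1 / η := by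
          have h3 : 0 ≤ (η * |r * z 0| - 1) ^ 2 / η := by positivity
          have h4 : (η * |r * z 0| - 1) ^ 2 / η =
              η * (r * z 0) ^ 2 + 1 / η - 2 * |r * z 0| := by
            rw [← sq_abs (r * z 0)]
            field_simp
            ring
          linarith [abs_nonneg (r * z 0)]
        rw [h1, norm_mul, Complex.norm_exp_ofReal_mul_I, one_mul]
        calc _ ≤ ‖k * (r * z 0)‖ := Real.norm_exp_I_mul_ofReal_sub_one_le
          _ = |k| * |r * z 0| := by rw [Real.norm_eq_abs, abs_mul]
          _ ≤ _ := by gcongr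
    _ = |k| * (η * (∫ z, (r * z 0) ^ 2 ∂μ) + 1 / η) := by
        rw [integral_const_mul, integral_add (hi.const_mul η) (integrable_const _),
          integral_const_mul]
        simp
    _ ≤ _ := by gcongr

lemma norm_charFun₂_le_one (μ : Measure (Fin 2 → ℝ)) [IsProbabilityMeasure μ] (α β : ℝ) :
    ‖charFun₂ μ α β‖ ≤ 1 := by
  refine (norm_integral_le_of_norm_le (integrable_const (1 : ℝ)) (ae_of_all _ fun z => ?_)).trans
    (by simp)
  exact (Complex.norm_exp_ofReal_mul_I _).le

lemma charFun₂_eq_of_fst {μ : Measure (Fin 2 → ℝ)} (hμ : ∀ᵐ z ∂μ, z 0 = 0) (α α' β : ℝ) :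
    charFun₂ μ α β = charFun₂ μ α' β :=
  integral_congr_ae (hμ.mono fun z hz => by simp [hz])

lemma charFun₂_zero_of_snd {μ : Measure (Fin 2 → ℝ)} [IsProbabilityMeasure μ]
    (hμ : ∀ᵐ z ∂μ, z 1 = 0) (β : ℝ) : charFun₂ μ 0 β = 1 := by
  have : charFun₂ μ 0 β = ∫ _, (1 : ℂ) ∂μ :=
    integral_congr_ae (hμ.mono fun z hz => by simp [hz])
  simpa using this

lemma measurableSet_posOrthant (d : ℕ) : MeasurableSet (posOrthant d) := by
  have : posOrthant d = ⋂ i, {z | 0 ≤ z i} := by ext; simp [posOrthant]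
  rw [this]
  exact MeasurableSet.iInter fun i => measurableSet_le measurable_const (measurable_pi_apply i)

lemma BARFamily.ae_mem {d : ℕ} {Γ R : Matrix (Fin d) (Fin d) ℝ}
    {π : ℝ → Measure (Fin d → ℝ)} {ν : Fin d → ℝ → Measure (Fin d → ℝ)}
    (h : BARFamily Γ R π ν) {r : ℝ} (hr : r ∈ Set.Ioo (0 : ℝ) 1) :
    ∀ᵐ z ∂(π r), z ∈ posOrthant d := by
  obtain ⟨h1, h2, -⟩ := h r hr
  exact (mem_ae_iff_prob_eq_one (measurableSet_posOrthant d)).2 h2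

lemma BARFamily.ae_mem_face {d : ℕ} {Γ R : Matrix (Fin d) (Fin d) ℝ}
    {π : ℝ → Measure (Fin d → ℝ)} {ν : Fin d → ℝ → Measure (Fin d → ℝ)}
    (h : BARFamily Γ R π ν) {r : ℝ} (hr : r ∈ Set.Ioo (0 : ℝ) 1) (i : Fin d) :
    ∀ᵐ z ∂(ν i r), z ∈ posOrthant d ∧ z i = 0 := by
  obtain ⟨-, -, h3, -⟩ := h r hr
  obtain ⟨h4, h5⟩ := h3 i
  exact (mem_ae_iff_prob_eq_one ((measurableSet_posOrthant d).inter
    (measurableSet_eq_fun (measurable_pi_apply i) measurable_const))).2 h5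

/-- The second moments of `r Z₁` are bounded under `π r` and are `O(1/r)` under `ν 1 r`. -/
lemma BARFamily.exists_moment_bound {Γ R : Matrix (Fin 2) (Fin 2) ℝ}
    {π : ℝ → Measure (Fin 2 → ℝ)} {ν : Fin 2 → ℝ → Measure (Fin 2 → ℝ)}
    (h : BARFamily Γ R π ν) (hΓ : Γ.IsSymm)
    (hΓ0 : 0 < Γ 0 0) (hΓ1 : 0 < Γ 1 1) (hR0 : 0 < R 0 0) (hR1 : 0 < R 1 1)
    (hdet : 0 < R 0 0 * R 1 1 - R 0 1 * R 1 0) :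
    ∃ K ≥ 0, ∀ᶠ r in nhdsWithin 0 (Set.Ioo (0 : ℝ) 1),
      (Integrable (fun z => (r * z 0) ^ 2) (π r) ∧ ∫ z, (r * z 0) ^ 2 ∂(π r) ≤ K) ∧
      Integrable (fun z => (r * z 0) ^ 2) (ν 1 r) ∧ ∫ z, (r * z 0) ^ 2 ∂(ν 1 r) ≤ K / r := by
  obtain ⟨r₀, hr₀, δ₀, hδ₀, K, hK, hb⟩ := exists_polyExp_moment_bound hΓ hΓ0 hΓ1 hR0 hR1 hdet
  refine ⟨K, hK, ?_⟩
  filter_upwards [self_mem_nhdsWithin, mem_nhdsWithin_of_mem_nhds (Iio_mem_nhds hr₀)] with r hr hr'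
  obtain ⟨h1, -, h3, h4⟩ := h r hr
  have := (h3 1).1
  have hb' := hb r hr.1 hr.2 hr' (π r) (fun i => ν i r) h1 h4 (h.ae_mem hr)
    ((h.ae_mem_face hr 0).mono fun z hz => hz.2) ((h.ae_mem_face hr 1).mono fun z hz => hz.2)
  refine ⟨integrable_sq_of_polyExp_le (h.ae_mem hr) hr.1.le hδ₀ hK fun δ h0 h1 => (hb' δ h0 h1).1,
    integrable_sq_of_polyExp_le ((h.ae_mem_face hr 1).mono fun z hz => hz.1) hr.1.le hδ₀
      (div_nonneg hK hr.1.le) fun δ h0 h1 => ?_⟩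
  rw [le_div_iff₀ hr.1, mul_comm]
  exact (hb' δ h0 h1).2

section Asymptotics

variable {Γ R : Matrix (Fin 2) (Fin 2) ℝ}
  {π : ℝ → Measure (Fin 2 → ℝ)} {ν : Fin 2 → ℝ → Measure (Fin 2 → ℝ)}

lemma tendsto_nhdsWithin_Ioo {f : ℝ → ℝ} (hf : ContinuousAt f 0) :
    Tendsto f (nhdsWithin 0 (Set.Ioo (0 : ℝ) 1)) (nhds (f 0)) :=
  hf.tendsto.mono_left nhdsWithin_le_nhds

lemma one_sub_I_mul_ofReal_ne_zero (x : ℝ) : 1 - Complex.I * x ≠ 0 := fun h => by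
  simpa using congrArg Complex.re h

/-- Along `u₂`, the characteristic function converges to that of the second exponential. -/
lemma BARFamily.tendsto_charFun₂_snd (h : BARFamily Γ R π ν) (hΓ : Γ.IsSymm)
    (hΓ0 : 0 < Γ 0 0) (hΓ1 : 0 < Γ 1 1) (hR0 : 0 < R 0 0) (hR1 : 0 < R 1 1)
    (hdet : 0 < R 0 0 * R 1 1 - R 0 1 * R 1 0) {w m : ℝ} (hw : w = -(R 1 0) / R 0 0)
    (hm : 2 * (w * R 0 1 + R 1 1) * m = Γ 0 0 * w ^ 2 + 2 * Γ 0 1 * w + Γ 1 1) (t : ℝ) :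
    Tendsto (fun r => charFun₂ (π r) (w * r ^ 2 * t) (r ^ 2 * t))
      (nhdsWithin 0 (Set.Ioo 0 1)) (nhds (1 - Complex.I * m * t)⁻¹) := by
  have hw' : R 0 0 * w + R 1 0 = 0 := by rw [hw]; field_simp; ring
  have hρ : w * R 0 1 + R 1 1 ≠ 0 := by
    have : R 0 0 * (w * R 0 1 + R 1 1) = R 0 0 * R 1 1 - R 0 1 * R 1 0 := by
      linear_combination R 0 1 * hw'
    exact right_ne_zero_of_mul (this ▸ hdet.ne')
  obtain ⟨K, hK, hb⟩ := h.exists_moment_bound hΓ hΓ0 hΓ1 hR0 hR1 hdet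
  have hlim : Tendsto (fun r => charFun₂ (ν 1 r) (w * r ^ 2 * t) (r ^ 2 * t))
      (nhdsWithin 0 (Set.Ioo 0 1)) (nhds 1) := by
    rw [tendsto_iff_norm_sub_tendsto_zero]
    have h0 : Tendsto (fun r : ℝ => |w * t| * (√r * (K + 1)))
        (nhdsWithin 0 (Set.Ioo 0 1)) (nhds 0) := by
      simpa using tendsto_nhdsWithin_Ioo (f := fun r : ℝ => |w * t| * (√r * (K + 1)))
        (by fun_prop)
    refine squeeze_zero' (Eventually.of_forall fun r => norm_nonneg _) ?_ h0
    filter_upwards [hb, self_mem_nhdsWithin] with r hr hr'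
    have hp := (h r hr').2.2.1 1 |>.1
    have hs : 0 < √r := Real.sqrt_pos.2 hr'.1
    have key := norm_charFun₂_sub_le hr.2.1 hr.2.2 (w * r * t) 0 (r ^ 2 * t) hs
    rw [charFun₂_zero_of_snd ((h.ae_mem_face hr' 1).mono fun z hz => hz.2)] at key
    have e1 : 0 + w * r * t * r = w * r ^ 2 * t := by ring
    have e2 : |w * r * t| * (√r * (K / r) + 1 / √r) = |w * t| * (√r * (K + 1)) := by
      rw [show w * r * t = w * t * r by ring, abs_mul, abs_of_pos hr'.1, mul_assoc]
      congr 1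
      have h3 : r = √r * √r := (Real.mul_self_sqrt hr'.1.le).symm
      have h4 : r / √r = √r := Real.div_sqrt
      have h5 : r * (√r * (K / r)) = √r * K := by have := hr'.1.ne'; field_simp
      rw [mul_add, h5, mul_one_div, h4]
      ring
    rwa [e1, e2] at key
  have hne : (1 - Complex.I * m * t) ≠ 0 := by
    simpa [mul_assoc] using one_sub_I_mul_ofReal_ne_zero (m * t)
  have hlim' := hlim.mul_const (1 - Complex.I * m * t)⁻¹
  rw [one_mul] at hlim'
  refine hlim'.congr' ?_
  filter_upwards [self_mem_nhdsWithin] with r hr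
  obtain ⟨h1, -, h3, h4⟩ := h r hr
  rw [← div_eq_mul_inv, div_eq_iff hne]
  rcases eq_or_ne t 0 with rfl | ht
  · have := (h3 1).1
    simp [charFun₂]
  have := fun i => (h3 i).1
  have key := h4.eq_cexp hΓ (w * r ^ 2 * t) (r ^ 2 * t)
  have hr0 : (r : ℂ) ≠ 0 := by exact_mod_cast hr.1.ne'
  have ht0 : (t : ℂ) ≠ 0 := by exact_mod_cast ht
  have hρ0 : (w * R 0 1 + R 1 1 : ℂ) ≠ 0 := by exact_mod_cast hρ
  have hwc : (R 0 0 * w + R 1 0 : ℂ) = 0 := by exact_mod_cast hw'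
  have hmc : (2 * (w * R 0 1 + R 1 1) * m : ℂ) = Γ 0 0 * w ^ 2 + 2 * Γ 0 1 * w + Γ 1 1 := by
    exact_mod_cast hm
  have hfac : (r ^ 4 * t * (w * R 0 1 + R 1 1) : ℂ) ≠ 0 := by positivity
  refine mul_left_cancel₀ hfac ?_
  push_cast at key
  generalize charFun₂ (π r) (w * r ^ 2 * t) (r ^ 2 * t) = P at *
  generalize charFun₂ (ν 1 r) (w * r ^ 2 * t) (r ^ 2 * t) = P1 at *
  generalize charFun₂ (ν 0 r) (w * r ^ 2 * t) (r ^ 2 * t) = P0 at *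
  linear_combination Complex.I * key + Complex.I * P * r ^ 4 * t ^ 2 / 2 * hmc
    - Complex.I ^ 2 * r ^ 3 * t * (P - P0) * hwc
    - r ^ 4 * t * (w * R 0 1 + R 1 1) * (P - P1) * Complex.I_sq

/-- Separation of the first coordinate. -/
lemma BARFamily.tendsto_charFun₂_fst (h : BARFamily Γ R π ν) (hΓ : Γ.IsSymm)
    (hR0 : 0 < R 0 0) {w : ℝ} (hw : w = -(R 1 0) / R 0 0) {s : ℝ} (hs : s ≠ 0) (t : ℝ) :
    Tendsto (fun r => charFun₂ (π r) (w * r ^ 2 * t + s * r) (r ^ 2 * t) *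
        (1 - Complex.I * (Γ 0 0 / (2 * R 0 0) : ℝ) * s) -
        charFun₂ (ν 0 r) 0 (r ^ 2 * t))
      (nhdsWithin 0 (Set.Ioo 0 1)) (nhds 0) := by
  have hw' : R 0 0 * w + R 1 0 = 0 := by rw [hw]; field_simp; ring
  have h0 : Tendsto (fun r : ℝ => |1 / (s * R 0 0)| *
      (|1 / 2 * (Γ 0 0 * (w * r * t + s) ^ 2 + 2 * Γ 0 1 * (w * r * t + s) * (r * t)
        + Γ 1 1 * (r * t) ^ 2) - 1 / 2 * Γ 0 0 * s ^ 2| +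
        |r * (R 0 1 * (w * r * t + s) + R 1 1 * (r * t))| * 2))
      (nhdsWithin 0 (Set.Ioo 0 1)) (nhds 0) := by
    convert tendsto_nhdsWithin_Ioo (f := fun r : ℝ => |1 / (s * R 0 0)| *
      (|1 / 2 * (Γ 0 0 * (w * r * t + s) ^ 2 + 2 * Γ 0 1 * (w * r * t + s) * (r * t)
        + Γ 1 1 * (r * t) ^ 2) - 1 / 2 * Γ 0 0 * s ^ 2| +
        |r * (R 0 1 * (w * r * t + s) + R 1 1 * (r * t))| * 2)) (by fun_prop) using 2
    ring_nf
    simp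
  refine squeeze_zero_norm' ?_ h0
  filter_upwards [self_mem_nhdsWithin] with r hr
  obtain ⟨h1, -, h3, h4⟩ := h r hr
  have := fun i => (h3 i).1
  have key := h4.eq_cexp hΓ (w * r ^ 2 * t + s * r) (r ^ 2 * t)
  have n := norm_charFun₂_le_one (π r) (w * r ^ 2 * t + s * r) (r ^ 2 * t)
  have n1 := norm_charFun₂_le_one (ν 1 r) (w * r ^ 2 * t + s * r) (r ^ 2 * t)
  rw [charFun₂_eq_of_fst ((h.ae_mem_face hr 0).mono fun z hz => hz.2) _ 0] at key
  generalize charFun₂ (π r) (w * r ^ 2 * t + s * r) (r ^ 2 * t) = P at *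
  generalize charFun₂ (ν 1 r) (w * r ^ 2 * t + s * r) (r ^ 2 * t) = P1 at *
  generalize charFun₂ (ν 0 r) 0 (r ^ 2 * t) = P0 at *
  obtain ⟨a, ha⟩ : ∃ a, a = 1 / 2 * (Γ 0 0 * (w * r * t + s) ^ 2
    + 2 * Γ 0 1 * (w * r * t + s) * (r * t) + Γ 1 1 * (r * t) ^ 2) - 1 / 2 * Γ 0 0 * s ^ 2 :=
    ⟨_, rfl⟩
  obtain ⟨b, hb⟩ : ∃ b, b = r * (R 0 1 * (w * r * t + s) + R 1 1 * (r * t)) := ⟨_, rfl⟩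
  rw [← ha, ← hb]
  have hrc : (r : ℂ) ≠ 0 := by exact_mod_cast hr.1.ne'
  have hsc : (s : ℂ) ≠ 0 := by exact_mod_cast hs
  have hRc : (R 0 0 : ℂ) ≠ 0 := by exact_mod_cast hR0.ne'
  have hwc : (R 0 0 * w + R 1 0 : ℂ) = 0 := by exact_mod_cast hw'
  have hac := congrArg (fun x : ℝ => (x : ℂ)) ha
  have hbc := congrArg (fun x : ℝ => (x : ℂ)) hb
  push_cast at key hac hbc
  have e : P * (1 - Complex.I * (Γ 0 0 / (2 * R 0 0) : ℝ) * s) - P0 =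
      (1 / (s * R 0 0) : ℝ) * (Complex.I * (a * P) - b * (P - P1)) := by
    have e' : s * R 0 0 * (P - P0) - Complex.I * (Γ 0 0 / 2) * s ^ 2 * P =
        Complex.I * (a * P) - b * (P - P1) := by
      refine mul_left_cancel₀ (pow_ne_zero 2 hrc) ?_
      rw [hac, hbc]
      linear_combination -Complex.I * key + Complex.I ^ 2 * r ^ 3 * t * (P - P0) * hwc
        + r ^ 2 * (s * R 0 0 * (P - P0)
          + r * (R 0 1 * (w * r * t + s) + R 1 1 * (r * t)) * (P - P1)) * Complex.I_sq
    rw [← e']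
    push_cast
    field_simp
    ring
  rw [e, norm_mul, Complex.norm_real, Real.norm_eq_abs]
  gcongr
  refine (norm_sub_le _ _).trans (add_le_add ?_ ?_)
  · rw [norm_mul, Complex.norm_I, one_mul, norm_mul, Complex.norm_real, Real.norm_eq_abs]
    exact mul_le_of_le_one_right (abs_nonneg _) n
  · rw [norm_mul, Complex.norm_real, Real.norm_eq_abs]
    gcongr
    exact (norm_sub_le _ _).trans (by linarith)

/-- The characteristic functions of the rescaled laws converge pointwise. -/
lemma BARFamily.tendsto_charFun₂ (h : BARFamily Γ R π ν) (hΓ : Γ.IsSymm)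
    (hΓ0 : 0 < Γ 0 0) (hΓ1 : 0 < Γ 1 1) (hR0 : 0 < R 0 0) (hR1 : 0 < R 1 1)
    (hdet : 0 < R 0 0 * R 1 1 - R 0 1 * R 1 0) {w m : ℝ} (hw : w = -(R 1 0) / R 0 0)
    (hm : 2 * (w * R 0 1 + R 1 1) * m = Γ 0 0 * w ^ 2 + 2 * Γ 0 1 * w + Γ 1 1) (s t : ℝ) :
    Tendsto (fun r => charFun₂ (π r) (r * s) (r ^ 2 * t)) (nhdsWithin 0 (Set.Ioo 0 1))
      (nhds ((1 - Complex.I * (Γ 0 0 / (2 * R 0 0) : ℝ) * s)⁻¹ *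
        (1 - Complex.I * m * t)⁻¹)) := by
  obtain ⟨m₀, hm₀⟩ : ∃ m₀, m₀ = Γ 0 0 / (2 * R 0 0) := ⟨_, rfl⟩
  obtain ⟨K, hK, hb⟩ := h.exists_moment_bound hΓ hΓ0 hΓ1 hR0 hR1 hdet
  have hsnd := h.tendsto_charFun₂_snd hΓ hΓ0 hΓ1 hR0 hR1 hdet hw hm t
  have hfst {s : ℝ} (hs : s ≠ 0) := h.tendsto_charFun₂_fst hΓ hR0 hw hs t
  rw [← hm₀] at hfst ⊢
  set L := (1 - Complex.I * m * t)⁻¹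
  have hbd : Tendsto (fun r => charFun₂ (ν 0 r) 0 (r ^ 2 * t))
      (nhdsWithin 0 (Set.Ioo 0 1)) (nhds L) := by
    rw [Metric.tendsto_nhds]
    intro ε hε
    obtain ⟨s, hs⟩ : ∃ s, s = ε / (3 * (|m₀| + K + 1)) := ⟨_, rfl⟩
    have hs0 : 0 < s := by rw [hs]; positivity
    have hsε : s * (|m₀| + K + 1) = ε / 3 := by rw [hs]; field_simp
    filter_upwards [hb, self_mem_nhdsWithin, Metric.tendsto_nhds.1 hsnd (ε / 3) (by positivity),
      Metric.tendsto_nhds.1 (hfst hs0.ne') (ε / 3) (by positivity)] with r hr hr' h1 h2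
    have := (h r hr').1
    have h3 := norm_charFun₂_sub_le hr.1.1 hr.1.2 s (w * r ^ 2 * t) (r ^ 2 * t) one_pos
    have h4 := norm_charFun₂_le_one (π r) (w * r ^ 2 * t + s * r) (r ^ 2 * t)
    generalize charFun₂ (π r) (w * r ^ 2 * t + s * r) (r ^ 2 * t) = P at *
    generalize charFun₂ (π r) (w * r ^ 2 * t) (r ^ 2 * t) = Q at *
    generalize charFun₂ (ν 0 r) 0 (r ^ 2 * t) = B at *
    rw [dist_zero_right] at h2
    rw [dist_eq_norm] at h1 ⊢
    rw [abs_of_pos hs0] at h3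
    have h5 : ‖P * (Complex.I * m₀ * s)‖ ≤ s * |m₀| := by
      rw [norm_mul, norm_mul, norm_mul, Complex.norm_I, Complex.norm_real, Complex.norm_real,
        Real.norm_eq_abs, Real.norm_eq_abs, abs_of_pos hs0, one_mul, mul_comm s]
      exact mul_le_of_le_one_left (by positivity) h4
    have e : B - L = -(P * (1 - Complex.I * m₀ * s) - B) - P * (Complex.I * m₀ * s)
        + (P - Q) + (Q - L) := by ring
    rw [e]
    calc _ ≤ ‖P * (1 - Complex.I * m₀ * s) - B‖ + ‖P * (Complex.I * m₀ * s)‖ + ‖P - Q‖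
          + ‖Q - L‖ := by
          refine (norm_add_le _ _).trans (add_le_add_left ((norm_add_le _ _).trans
            (add_le_add_left ((norm_sub_le _ _).trans ?_) _)) _)
          rw [norm_neg]
      _ < ε := by linarith
  have hne : 1 - Complex.I * m₀ * s ≠ 0 := by
    simpa [mul_assoc] using one_sub_I_mul_ofReal_ne_zero (m₀ * s)
  have hP : Tendsto (fun r => charFun₂ (π r) (w * r ^ 2 * t + s * r) (r ^ 2 * t))
      (nhdsWithin 0 (Set.Ioo 0 1)) (nhds ((1 - Complex.I * m₀ * s)⁻¹ * L)) := by
    rcases eq_or_ne s 0 with rfl | hs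
    · simpa using hsnd
    have := ((hfst hs).add hbd).const_mul (1 - Complex.I * m₀ * s)⁻¹
    rw [zero_add] at this
    refine this.congr fun r => ?_
    field_simp
    ring
  have h0 : Tendsto (fun r : ℝ => |-(w * r * t)| * (1 * K + 1 / 1))
      (nhdsWithin 0 (Set.Ioo 0 1)) (nhds 0) := by
    simpa using tendsto_nhdsWithin_Ioo (f := fun r : ℝ => |-(w * r * t)| * (1 * K + 1 / 1))
      (by fun_prop)
  have hd : Tendsto (fun r => charFun₂ (π r) (r * s) (r ^ 2 * t) -
      charFun₂ (π r) (w * r ^ 2 * t + s * r) (r ^ 2 * t))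
      (nhdsWithin 0 (Set.Ioo 0 1)) (nhds 0) := by
    refine squeeze_zero_norm' ?_ h0
    filter_upwards [hb, self_mem_nhdsWithin] with r hr hr'
    have := (h r hr').1
    have key := norm_charFun₂_sub_le hr.1.1 hr.1.2 (-(w * r * t)) (w * r ^ 2 * t + s * r)
      (r ^ 2 * t) one_pos
    rwa [show w * r ^ 2 * t + s * r + -(w * r * t) * r = r * s by ring] at key
  simpa using hd.add hP

end Asymptotics

lemma IsPMatrix.two_dim {R : Matrix (Fin 2) (Fin 2) ℝ} (hR : IsPMatrix R) :
    0 < R 0 0 ∧ 0 < R 1 1 ∧ 0 < R 0 0 * R 1 1 - R 0 1 * R 1 0 := by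
  have h1 (i : Fin 2) : 0 < R i i := by
    have h := hR {i}
    let : Unique ({i} : Finset (Fin 2)) :=
      ⟨⟨⟨i, by simp⟩⟩, fun x => Subtype.ext (Finset.mem_singleton.1 x.2)⟩
    rwa [Matrix.det_unique] at h
  refine ⟨h1 0, h1 1, ?_⟩
  have h := hR Finset.univ
  let e : Fin 2 ≃ (Finset.univ : Finset (Fin 2)) :=
    (Equiv.subtypeUnivEquiv fun x => Finset.mem_univ x).symm
  rw [← Matrix.det_submatrix_equiv_self e, Matrix.det_fin_two] at h
  exact h

/-- Steady-state convergence of two-dimensional SRBM in the multi-scaling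
regime for a 2×2 P-reflection matrix, with `m_1 = Γ_{11}/(2R_{11})`,
`m_2 = (u_2ᵀ Γ u_2)/(2 u_2ᵀ R_{:,2})`, `u_2 = (−R_{21}/R_{11}, 1)ᵀ`. -/
theorem srbm_steady_state_convergence_two_dim
    (Γ R : Matrix (Fin 2) (Fin 2) ℝ)
    (hΓsymm : Γ.IsSymm) (hΓpd : Γ.PosDef)
    (hR : IsPMatrix R)
    (π : ℝ → Measure (Fin 2 → ℝ)) (ν : Fin 2 → ℝ → Measure (Fin 2 → ℝ))
    (hBAR : BARFamily Γ R π ν) :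
    0 < Γ 0 0 / (2 * R 0 0) ∧
    0 < quadForm Γ ![-(R 1 0) / R 0 0, 1] / (2 * uR R ![-(R 1 0) / R 0 0, 1] 1) ∧
    ScaledWeakLimit π (prodExp
      ![Γ 0 0 / (2 * R 0 0),
        quadForm Γ ![-(R 1 0) / R 0 0, 1] / (2 * uR R ![-(R 1 0) / R 0 0, 1] 1)]) := by
  obtain ⟨hR0, hR1, hdet⟩ := hR.two_dim
  have hΓ0 : 0 < Γ 0 0 := hΓpd.diag_pos
  have hΓ1 : 0 < Γ 1 1 := hΓpd.diag_pos
  obtain ⟨w, hw⟩ : ∃ w, w = -(R 1 0) / R 0 0 := ⟨_, rfl⟩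
  rw [← hw]
  have hQ : quadForm Γ ![w, 1] = Γ 0 0 * w ^ 2 + 2 * Γ 0 1 * w + Γ 1 1 := by
    have h10 : Γ 1 0 = Γ 0 1 := hΓsymm.apply 0 1
    simp [quadForm, Fin.sum_univ_two, h10]
    ring
  have hQ0 : 0 < quadForm Γ ![w, 1] := by
    have h := hΓpd.dotProduct_mulVec_pos (x := ![w, 1]) (fun h => by simpa using congrFun h 1)
    refine h.trans_eq ?_
    simp [quadForm, Fin.sum_univ_two, Matrix.mulVec, dotProduct]
    ring
  have hρ : uR R ![w, 1] 1 = w * R 0 1 + R 1 1 := by simp [uR, Fin.sum_univ_two]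
  have hρ0 : 0 < uR R ![w, 1] 1 := by
    have : uR R ![w, 1] 1 = (R 0 0 * R 1 1 - R 0 1 * R 1 0) / R 0 0 := by
      rw [hρ, hw]
      field_simp
      ring
    rw [this]
    positivity
  have hm0 : 0 < Γ 0 0 / (2 * R 0 0) := by positivity
  have hm1 : 0 < quadForm Γ ![w, 1] / (2 * uR R ![w, 1] 1) := by positivity
  refine ⟨hm0, hm1, scaledWeakLimit_of_tendsto_charFun (fun r hr => (hBAR r hr).1)
    (Fin.forall_fin_two.2 ⟨hm0, hm1⟩) fun s t => ?_⟩
  refine hBAR.tendsto_charFun₂ hΓsymm hΓ0 hΓ1 hR0 hR1 hdet hw ?_ s t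
  simp only [Matrix.cons_val_one, Matrix.cons_val_zero]
  rw [← hρ, ← hQ]
  field_simp

end SRBMPaper
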